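/- Let k be a non-archimedean local field of characteristic zero, let m ≠ n be positive integers, and let G = GL_m(k) × GL_n(k) act on the space M_{m,n} of m×n matrices over k by (g₁,g₂)·x := g₁xg₂⁻¹. For characters χ₁, χ₂ of k^×, write (χ₁,χ₂) for the character (g₁,g₂) ↦ χ₁(det g₁)χ₂(det g₂) of G. Then: (a) if (χ₁,χ₂) = (1,1), the space of generalized (χ₁,χ₂)-invariant distributions on M_{m,n} equals the space of (χ₁,χ₂)-invariant distributions and is ℂ·δ₀, where δ₀ is the delta distribution φ ↦ φ(0); (b) if (χ₁,χ₂) = (|·|_k^n, |·|_k^{−m}), both spaces equal ℂ·μ, where μ is a Haar measure on M_{m,n}; (c) for all other characters (χ₁,χ₂), the space of generalized (χ₁,χ₂)-invariant distributions on M_{m,n} is zero. -/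

import Mathlib

open Matrix MeasureTheory

section

/-- The space `𝒮(X)` of Bruhat–Schwartz functions on an ℓ-space `X`: compactly supported
locally constant complex-valued functions. -/
noncomputable def SchwartzBZ (X : Type*) [TopologicalSpace X] : Submodule ℂ (X → ℂ) where
  carrier := {φ | IsLocallyConstant φ ∧ HasCompactSupport φ}
  add_mem' hφ hψ := ⟨hφ.1.comp₂ hψ.1 (· + ·), hφ.2.add hψ.2⟩
  zero_mem' := ⟨IsLocallyConstant.const 0, HasCompactSupport.zero⟩
  smul_mem' c φ hφ := ⟨hφ.1.comp (c • ·), hφ.2.mono (Function.support_const_smul_subset c φ)⟩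

/-- Pullback of Bruhat–Schwartz functions along a homeomorphism. -/
noncomputable def pullbackS {X : Type*} [TopologicalSpace X] (e : X ≃ₜ X) :
    SchwartzBZ X →ₗ[ℂ] SchwartzBZ X where
  toFun φ := ⟨(φ : X → ℂ) ∘ e, (φ.2.1).comp_continuous e.continuous,
    φ.2.2.comp_homeomorph e⟩
  map_add' φ ψ := rfl
  map_smul' c φ := rfl

variable {K : Type*} [NontriviallyNormedField K] {m n : ℕ}

/-- The homeomorphism `x ↦ g₁ x g₂⁻¹` of `M_{m,n}(K)` attached to
`(g₁,g₂) ∈ GL_m(K) × GL_n(K)`. -/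
noncomputable def matActHomeo (g₁ : GL (Fin m) K) (g₂ : GL (Fin n) K) :
    Matrix (Fin m) (Fin n) K ≃ₜ Matrix (Fin m) (Fin n) K where
  toFun x := (g₁ : Matrix (Fin m) (Fin m) K) * x *
    ((g₂⁻¹ : GL (Fin n) K) : Matrix (Fin n) (Fin n) K)
  invFun x := ((g₁⁻¹ : GL (Fin m) K) : Matrix (Fin m) (Fin m) K) * x *
    (g₂ : Matrix (Fin n) (Fin n) K)
  left_inv x := by
    have h1 : IsUnit ((g₁ : Matrix (Fin m) (Fin m) K)).det := by
      rw [← Matrix.isUnit_iff_isUnit_det]; exact g₁.isUnit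
    have h2 : IsUnit ((g₂ : Matrix (Fin n) (Fin n) K)).det := by
      rw [← Matrix.isUnit_iff_isUnit_det]; exact g₂.isUnit
    simp only [Matrix.coe_units_inv]
    rw [Matrix.mul_assoc, Matrix.mul_assoc, Matrix.nonsing_inv_mul _ h2, Matrix.mul_one,
      ← Matrix.mul_assoc, Matrix.nonsing_inv_mul _ h1, Matrix.one_mul]
  right_inv x := by
    have h1 : IsUnit ((g₁ : Matrix (Fin m) (Fin m) K)).det := by
      rw [← Matrix.isUnit_iff_isUnit_det]; exact g₁.isUnit
    have h2 : IsUnit ((g₂ : Matrix (Fin n) (Fin n) K)).det := by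
      rw [← Matrix.isUnit_iff_isUnit_det]; exact g₂.isUnit
    simp only [Matrix.coe_units_inv]
    rw [Matrix.mul_assoc, Matrix.mul_assoc, Matrix.mul_nonsing_inv _ h2, Matrix.mul_one,
      ← Matrix.mul_assoc, Matrix.mul_nonsing_inv _ h1, Matrix.one_mul]
  continuous_toFun := (continuous_const.matrix_mul continuous_id).matrix_mul continuous_const
  continuous_invFun := (continuous_const.matrix_mul continuous_id).matrix_mul continuous_const

/-- The action of `g = (g₁,g₂) ∈ GL_m(K) × GL_n(K)` on distributions on `M_{m,n}(K)`,
twisted by the character `(χ₁,χ₂)`:  `(g·η)(φ) = χ₁(det g₁) χ₂(det g₂) · η(g⁻¹·φ)`, where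
`(g⁻¹·φ)(x) = φ(g₁ x g₂⁻¹)`. -/
noncomputable def actDist (χ₁ χ₂ : Kˣ →* ℂˣ) (g : GL (Fin m) K × GL (Fin n) K)
    (η : SchwartzBZ (Matrix (Fin m) (Fin n) K) →ₗ[ℂ] ℂ) :
    SchwartzBZ (Matrix (Fin m) (Fin n) K) →ₗ[ℂ] ℂ :=
  ((χ₁ (Matrix.GeneralLinearGroup.det g.1) : ℂ) *
      (χ₂ (Matrix.GeneralLinearGroup.det g.2) : ℂ)) •
    (η ∘ₗ pullbackS (matActHomeo g.1 g.2))

/-- `η` is a `(χ₁,χ₂)`-invariant distribution on `M_{m,n}(K)`. -/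
def IsSemiInvDistrib (χ₁ χ₂ : Kˣ →* ℂˣ)
    (η : SchwartzBZ (Matrix (Fin m) (Fin n) K) →ₗ[ℂ] ℂ) : Prop :=
  ∀ g : GL (Fin m) K × GL (Fin n) K, actDist χ₁ χ₂ g η = η

/-- `η` is a generalized `(χ₁,χ₂)`-invariant distribution on `M_{m,n}(K)`:
`(g₀−1)(g₁−1)⋯(g_k−1)·η = 0` for some `k` and all `g₀,…,g_k ∈ G`. -/
def IsGenSemiInvDistrib (χ₁ χ₂ : Kˣ →* ℂˣ)
    (η : SchwartzBZ (Matrix (Fin m) (Fin n) K) →ₗ[ℂ] ℂ) : Prop :=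
  ∃ k : ℕ, ∀ l : List (GL (Fin m) K × GL (Fin n) K), l.length = k + 1 →
    l.foldr (fun g η' => actDist χ₁ χ₂ g η' - η') η = 0

variable (K)

/-- The character `|·|_k : K^× → ℂ^×` given by the (normalized) absolute value. -/
noncomputable def normChar : Kˣ →* ℂˣ where
  toFun a := Units.mk0 ((‖(a : K)‖ : ℝ) : ℂ)
    (by
      simp only [ne_eq, Complex.ofReal_eq_zero, norm_eq_zero]
      exact a.ne_zero)
  map_one' := by ext; simp
  map_mul' a b := by ext; simp [norm_mul]

/-- The delta distribution `δ₀ : φ ↦ φ(0)` at `0 ∈ M_{m,n}(K)`. -/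
noncomputable def deltaZero (m n : ℕ) :
    SchwartzBZ (Matrix (Fin m) (Fin n) K) →ₗ[ℂ] ℂ :=
  LinearMap.proj (0 : Matrix (Fin m) (Fin n) K) ∘ₗ
    (SchwartzBZ (Matrix (Fin m) (Fin n) K)).subtype

/-- The distribution given by integration against a measure `μ` on `M_{m,n}(K)`. -/
noncomputable def measDist (m n : ℕ) [MeasurableSpace (Matrix (Fin m) (Fin n) K)]
    [BorelSpace (Matrix (Fin m) (Fin n) K)]
    (μ : Measure (Matrix (Fin m) (Fin n) K)) [μ.IsAddHaarMeasure] :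
    SchwartzBZ (Matrix (Fin m) (Fin n) K) →ₗ[ℂ] ℂ where
  toFun φ := ∫ x, (φ : Matrix (Fin m) (Fin n) K → ℂ) x ∂μ
  map_add' φ ψ := by
    exact integral_add
      ((φ.2.1.continuous).integrable_of_hasCompactSupport φ.2.2)
      ((ψ.2.1.continuous).integrable_of_hasCompactSupport ψ.2.2)
  map_smul' c φ := by
    simpa using integral_smul c (φ : Matrix (Fin m) (Fin n) K → ℂ)

end

open Set Filter Topology

section SchwartzSpace

variable {X Y : Type*} [TopologicalSpace X] [TopologicalSpace Y]

theorem SchwartzBZ.isClopen_support (φ : SchwartzBZ X) :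
    IsClopen (Function.support (φ : X → ℂ)) :=
  (φ.2.1.isClopen_fiber 0).compl

theorem SchwartzBZ.isCompact_support (φ : SchwartzBZ X) :
    IsCompact (Function.support (φ : X → ℂ)) := by
  have h : IsCompact (tsupport (φ : X → ℂ)) := φ.2.2
  rwa [tsupport, (SchwartzBZ.isClopen_support φ).isClosed.closure_eq] at h

/-- Build a Bruhat–Schwartz function from a function which is locally constant at every point and
is supported inside a compact set. -/
def SchwartzBZ.mk [T2Space X] (f : X → ℂ) (h : ∀ x, ∀ᶠ y in 𝓝 x, f y = f x) (C : Set X)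
    (hC : IsCompact C) (hs : Function.support f ⊆ C) : SchwartzBZ X :=
  ⟨f, (IsLocallyConstant.iff_eventually_eq f).2 h,
    HasCompactSupport.of_support_subset_isCompact hC hs⟩

/-- Pullback of Bruhat–Schwartz functions along a homeomorphism between two spaces. -/
noncomputable def pullH (e : X ≃ₜ Y) : SchwartzBZ Y →ₗ[ℂ] SchwartzBZ X where
  toFun φ := ⟨(φ : Y → ℂ) ∘ e, (φ.2.1).comp_continuous e.continuous, φ.2.2.comp_homeomorph e⟩
  map_add' _ _ := rfl
  map_smul' _ _ := rfl

@[simp] theorem pullH_apply (e : X ≃ₜ Y) (φ : SchwartzBZ Y) (x : X) :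
    (pullH e φ : X → ℂ) x = (φ : Y → ℂ) (e x) := rfl

@[simp] theorem pullbackS_apply (e : X ≃ₜ X) (φ : SchwartzBZ X) (x : X) :
    (pullbackS e φ : X → ℂ) x = (φ : X → ℂ) (e x) := rfl

@[ext] theorem SchwartzBZ.ext' {φ ψ : SchwartzBZ X} (h : ∀ x, (φ : X → ℂ) x = (ψ : X → ℂ) x) :
    φ = ψ := Subtype.ext (funext h)

/-- The indicator function of a compact clopen set. -/
noncomputable def indS (C : Set X) (h : IsClopen C ∧ IsCompact C) : SchwartzBZ X :=
  ⟨C.indicator 1, (IsLocallyConstant.iff_eventually_eq _).2 fun x => by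
      by_cases hx : x ∈ C
      · filter_upwards [h.1.isOpen.mem_nhds hx] with y hy
        simp [hx, hy]
      · filter_upwards [h.1.compl.isOpen.mem_nhds hx] with y hy
        have : y ∉ C := hy
        simp [hx, this],
    h.2.of_isClosed_subset (isClosed_tsupport _)
      (closure_minimal Set.support_indicator_subset h.1.isClosed)⟩

@[simp] theorem indS_coe (C : Set X) (h : IsClopen C ∧ IsCompact C) :
    (indS C h : X → ℂ) = C.indicator 1 := rfl

/-- Multiplication by the indicator function of a clopen set. -/
noncomputable def restrS (C : Set X) (h : IsClopen C) : SchwartzBZ X →ₗ[ℂ] SchwartzBZ X where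
  toFun φ := ⟨C.indicator (φ : X → ℂ), (IsLocallyConstant.iff_eventually_eq _).2 fun x => by
      by_cases hx : x ∈ C
      · filter_upwards [h.isOpen.mem_nhds hx, φ.2.1.eventually_eq x] with y hy hy'
        simp [hx, hy, hy']
      · filter_upwards [h.compl.isOpen.mem_nhds hx] with y hy
        have : y ∉ C := hy
        simp [hx, this],
    φ.2.2.mono fun x hx h0 => hx (by simp [indicator, h0])⟩
  map_add' φ ψ := Subtype.ext (Set.indicator_add _ _ _)
  map_smul' c φ := Subtype.ext (Set.indicator_const_smul _ c _)

@[simp] theorem restrS_coe (C : Set X) (h : IsClopen C) (φ : SchwartzBZ X) :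
    (restrS C h φ : X → ℂ) = C.indicator (φ : X → ℂ) := rfl

/-- The distribution `η` vanishes on the functions supported in `W`. -/
def Kills (η : SchwartzBZ X →ₗ[ℂ] ℂ) (W : Set X) : Prop :=
  ∀ φ : SchwartzBZ X, Function.support (φ : X → ℂ) ⊆ W → η φ = 0

theorem apply_eq_zero_of_local (η : SchwartzBZ X →ₗ[ℂ] ℂ) (φ : SchwartzBZ X) {π : X → Y}
    (hπ : Continuous π)
    (h : ∀ x ∈ Function.support (φ : X → ℂ), ∃ C, IsClopen C ∧ π x ∈ C ∧
      ∀ C' (hC' : IsClopen C'), C' ⊆ C → η (restrS (π ⁻¹' C') (hC'.preimage hπ) φ) = 0) :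
    η φ = 0 := by
  let p : Set X → Prop := fun S => ∃ C, IsClopen C ∧ S ⊆ π ⁻¹' C ∧
      ∀ C' (hC' : IsClopen C'), C' ⊆ C → η (restrS (π ⁻¹' C') (hC'.preimage hπ) φ) = 0
  have hp : p (Function.support (φ : X → ℂ)) := by
    refine (SchwartzBZ.isCompact_support φ).induction_on ?_ ?_ ?_ ?_
    · refine ⟨∅, isClopen_empty, empty_subset _, fun C' hC' hs => ?_⟩
      obtain rfl : C' = ∅ := subset_empty_iff.1 hs
      convert η.map_zero
      ext x
      simp
    · rintro s t hst ⟨C, h1, h2, h3⟩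
      exact ⟨C, h1, hst.trans h2, h3⟩
    · rintro s t ⟨C, h1, h2, h3⟩ ⟨D, k1, k2, k3⟩
      refine ⟨C ∪ D, h1.union k1, union_subset (h2.trans (preimage_mono subset_union_left))
        (k2.trans (preimage_mono subset_union_right)), fun C' hC' hs => ?_⟩
      have e : restrS (π ⁻¹' C') (hC'.preimage hπ) φ
          = restrS (π ⁻¹' (C' ∩ C)) ((hC'.inter h1).preimage hπ) φ
            + restrS (π ⁻¹' (C' \ C)) ((hC'.diff h1).preimage hπ) φ := by
        ext x
        by_cases hx : π x ∈ C' <;> by_cases hx' : π x ∈ C <;> simp [indicator, hx, hx']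
      rw [e, map_add, h3 _ (hC'.inter h1) inter_subset_right, k3 _ (hC'.diff h1), add_zero]
      rintro y ⟨hy1, hy2⟩
      exact (hs hy1).resolve_left hy2
    · intro x hx
      obtain ⟨C, h1, h2, h3⟩ := h x hx
      exact ⟨π ⁻¹' C, mem_nhdsWithin_of_mem_nhds ((h1.preimage hπ).isOpen.mem_nhds h2),
        C, h1, subset_rfl, h3⟩
  obtain ⟨C, h1, h2, h3⟩ := hp
  rw [← h3 C h1 subset_rfl]
  congr 1
  ext x
  by_cases hx : π x ∈ C
  · simp [hx]
  · have : (φ : X → ℂ) x = 0 := by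
      by_contra h0
      exact hx (h2 h0)
    simp [hx, this]

theorem Kills.mono {η : SchwartzBZ X →ₗ[ℂ] ℂ} {W W' : Set X} (h : Kills η W) (hs : W' ⊆ W) :
    Kills η W' := fun φ hφ => h φ (hφ.trans hs)

theorem kills_iUnion [T2Space X] [LocallyCompactSpace X] [TotallyDisconnectedSpace X]
    {ι : Type*} {η : SchwartzBZ X →ₗ[ℂ] ℂ} {W : ι → Set X}
    (hW : ∀ i, IsOpen (W i)) (h : ∀ i, Kills η (W i)) : Kills η (⋃ i, W i) := by
  intro φ hφ
  refine apply_eq_zero_of_local η φ continuous_id fun x hx => ?_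
  obtain ⟨i, hi⟩ := mem_iUnion.1 (hφ hx)
  obtain ⟨C, hC, hxC, hCW⟩ := loc_compact_Haus_tot_disc_of_zero_dim.exists_subset_of_mem_open
    hi (hW i)
  refine ⟨C, hC, hxC, fun C' hC' hs => h i _ ?_⟩
  exact Set.support_indicator_subset.trans (hs.trans hCW)

end SchwartzSpace

section Coset

variable {E : Type*} [AddCommGroup E] [TopologicalSpace E]

/-- The coset `y + L`. -/
def cosetSet (L : OpenAddSubgroup E) (y : E) : Set E := (fun x => x - y) ⁻¹' (L : Set E)

theorem mem_cosetSet {L : OpenAddSubgroup E} {x y : E} : x ∈ cosetSet L y ↔ x - y ∈ L := Iff.rfl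

end Coset

section Nonarchimedean

variable {E : Type*} [AddCommGroup E] [TopologicalSpace E] [NonarchimedeanAddGroup E]

theorem SchwartzBZ.exists_openAddSubgroup_invariant (φ : SchwartzBZ E) :
    ∃ L : OpenAddSubgroup E, ∀ x, ∀ l ∈ L, (φ : E → ℂ) (x + l) = (φ : E → ℂ) x := by
  have hp : ∃ L : OpenAddSubgroup E, ∀ x ∈ Function.support (φ : E → ℂ), ∀ l ∈ L,
      (φ : E → ℂ) (x + l) = (φ : E → ℂ) x := by
    refine (SchwartzBZ.isCompact_support φ).induction_on (p := fun S => ∃ L : OpenAddSubgroup E,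
      ∀ x ∈ S, ∀ l ∈ L, (φ : E → ℂ) (x + l) = (φ : E → ℂ) x) ?_ ?_ ?_ ?_
    · exact ⟨⊤, by simp⟩
    · rintro s t hst ⟨L, hL⟩
      exact ⟨L, fun x hx => hL x (hst hx)⟩
    · rintro s t ⟨L, hL⟩ ⟨L', hL'⟩
      refine ⟨L ⊓ L', fun x hx l hl => ?_⟩
      rcases hx with hx | hx
      · exact hL x hx l (OpenAddSubgroup.mem_inf.1 hl).1
      · exact hL' x hx l (OpenAddSubgroup.mem_inf.1 hl).2
    · intro x hx
      have h1 := φ.2.1.eventually_eq x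
      have h2 : Tendsto (fun l => x + l) (𝓝 (0 : E)) (𝓝 x) := by
        have : Continuous fun l => x + l := by fun_prop
        simpa using this.tendsto 0
      obtain ⟨L, hL⟩ := NonarchimedeanAddGroup.is_nonarchimedean _ (h2 h1)
      refine ⟨(fun y => -x + y) ⁻¹' (L : Set E), mem_nhdsWithin_of_mem_nhds
        ((L.isOpen.preimage (by fun_prop)).mem_nhds (by simp)), L, fun y hy l hl => ?_⟩
      have e1 : (φ : E → ℂ) (x + (-x + y)) = (φ : E → ℂ) x := hL hy
      have e2 : (φ : E → ℂ) (x + (-x + y + l)) = (φ : E → ℂ) x := hL (L.add_mem hy hl)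
      rw [← add_assoc] at e2
      simp only [add_neg_cancel_left] at e1 e2
      rw [e2, e1]
  obtain ⟨L, hL⟩ := hp
  refine ⟨L, fun x l hl => ?_⟩
  by_cases hx : (φ : E → ℂ) x = 0
  · by_contra h0
    rw [hx] at h0
    have := hL (x + l) h0 (-l) (L.neg_mem hl)
    rw [add_neg_cancel_right] at this
    exact h0 (this ▸ hx)
  · exact hL x hx l hl

theorem cosetSet_prop {L : OpenAddSubgroup E} (hL : IsCompact (L : Set E)) (y : E) :
    IsClopen (cosetSet L y) ∧ IsCompact (cosetSet L y) :=
  ⟨L.isClopen.preimage (by fun_prop), (Homeomorph.subRight y).isCompact_preimage.2 hL⟩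

/-- The indicator function of the coset `y + L`. -/
noncomputable def indC (L : OpenAddSubgroup E) (hL : IsCompact (L : Set E)) (y : E) :
    SchwartzBZ E := indS (cosetSet L y) (cosetSet_prop hL y)

theorem indC_apply_of_mem {L : OpenAddSubgroup E} (hL : IsCompact (L : Set E)) {x y : E}
    (h : x - y ∈ L) : (indC L hL y : E → ℂ) x = 1 := by
  have : x ∈ cosetSet L y := h
  simp [indC, this]

theorem indC_apply_of_notMem {L : OpenAddSubgroup E} (hL : IsCompact (L : Set E)) {x y : E}
    (h : x - y ∉ L) : (indC L hL y : E → ℂ) x = 0 := by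
  have : x ∉ cosetSet L y := h
  simp [indC, this]

theorem SchwartzBZ.exists_eq_sum_indC (φ : SchwartzBZ E) (L : OpenAddSubgroup E)
    (hL : IsCompact (L : Set E)) (hφ : ∀ x, ∀ l ∈ L, (φ : E → ℂ) (x + l) = (φ : E → ℂ) x) :
    ∃ F : Finset E, (∀ y ∈ F, y ∈ Function.support (φ : E → ℂ)) ∧
      (φ ≠ 0 → F.Nonempty) ∧ φ = ∑ y ∈ F, (φ : E → ℂ) y • indC L hL y := by
  classical
  let q : E → E ⧸ L.toAddSubgroup := QuotientAddGroup.mk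
  have : DiscreteTopology (E ⧸ L.toAddSubgroup) :=
    QuotientAddGroup.discreteTopology L.isOpen
  have hfin : (q '' Function.support (φ : E → ℂ)).Finite :=
    ((SchwartzBZ.isCompact_support φ).image QuotientAddGroup.continuous_mk).finite_of_discrete
  have hout : ∀ x, (φ : E → ℂ) (q x).out = (φ : E → ℂ) x := by
    intro x
    have h : -x + (q x).out ∈ L.toAddSubgroup := by
      rw [← QuotientAddGroup.eq]
      exact (Quotient.out_eq _).symm
    have := hφ x _ h
    rwa [add_neg_cancel_left] at this
  refine ⟨hfin.toFinset.image Quotient.out, ?_, ?_, ?_⟩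
  · intro y hy
    simp only [Finset.mem_image, Finite.mem_toFinset] at hy
    obtain ⟨a, ⟨x, hx, rfl⟩, rfl⟩ := hy
    rw [Function.mem_support, hout]
    exact hx
  · intro hne
    obtain ⟨x, hx⟩ : ∃ x, (φ : E → ℂ) x ≠ 0 := by
      by_contra! h
      exact hne (SchwartzBZ.ext' h)
    exact ⟨(q x).out, by
      simp only [Finset.mem_image, Finite.mem_toFinset]
      exact ⟨q x, ⟨x, hx, rfl⟩, rfl⟩⟩
  · ext x
    rw [Finset.sum_image (fun a _ b _ h => Quotient.out_injective h)]
    have key : ∀ a : E ⧸ L.toAddSubgroup, (indC L hL a.out : E → ℂ) x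
        = if q x = a then 1 else 0 := by
      intro a
      have : q x = a ↔ x - a.out ∈ L := by
        rw [← OpenAddSubgroup.mem_toAddSubgroup, sub_eq_neg_add, ← QuotientAddGroup.eq]
        constructor
        · rintro rfl
          exact Quotient.out_eq _
        · intro h
          exact h.symm.trans (Quotient.out_eq _)
      split_ifs with h
      · exact indC_apply_of_mem hL (this.1 h)
      · exact indC_apply_of_notMem hL (fun h' => h (this.2 h'))
    simp only [Submodule.coe_sum, Submodule.coe_smul, Finset.sum_apply, Pi.smul_apply, key,
      smul_eq_mul, mul_ite, mul_one, mul_zero, Finset.sum_ite_eq, Finite.mem_toFinset]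
    split_ifs with h
    · exact (hout x).symm
    · by_contra h0
      exact h ⟨x, h0, rfl⟩

theorem exists_openAddSubgroup_isCompact [LocallyCompactSpace E] {U : Set E} (hU : U ∈ 𝓝 (0 : E)) :
    ∃ L : OpenAddSubgroup E, (L : Set E) ⊆ U ∧ IsCompact (L : Set E) := by
  obtain ⟨C, hC, hCU, hCc⟩ := local_compact_nhds hU
  obtain ⟨L, hL⟩ := NonarchimedeanAddGroup.is_nonarchimedean _ hC
  exact ⟨L, hL.trans hCU, hCc.of_isClosed_subset L.isClosed hL⟩

/-- A distribution taking, for arbitrarily small `L`, a value on the cosets of `L` contained in `W`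
that is independent of the coset, and vanishing on one coset contained in `W`, vanishes on `W`. -/
theorem kills_of_indC_const (θ : SchwartzBZ E →ₗ[ℂ] ℂ) (W : Set E)
    (h : ∀ U ∈ 𝓝 (0 : E), ∃ (L : OpenAddSubgroup E) (hL : IsCompact (L : Set E)), (L : Set E) ⊆ U ∧
      ∀ y ∈ W, ∀ y' ∈ W, θ (indC L hL y) = θ (indC L hL y'))
    (L₀ : OpenAddSubgroup E) (hL₀ : IsCompact (L₀ : Set E)) (y₀ : E) (hy₀ : cosetSet L₀ y₀ ⊆ W)
    (h₀ : θ (indC L₀ hL₀ y₀) = 0) : Kills θ W := by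
  intro φ hφ
  obtain ⟨L₁, hL₁⟩ := SchwartzBZ.exists_openAddSubgroup_invariant φ
  obtain ⟨L, hL, hLU, hconst⟩ := h _ ((L₁ ⊓ L₀).isOpen.mem_nhds (zero_mem _))
  have hLL₁ : ∀ l ∈ L, l ∈ L₁ := fun l hl => (OpenAddSubgroup.mem_inf.1 (hLU hl)).1
  have hLL₀ : ∀ l ∈ L, l ∈ L₀ := fun l hl => (OpenAddSubgroup.mem_inf.1 (hLU hl)).2
  have hy₀' : y₀ ∈ cosetSet L₀ y₀ := mem_cosetSet.2 (by simp)
  have hz : θ (indC L hL y₀) = 0 := by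
    obtain ⟨F, hF, hne, hs⟩ := SchwartzBZ.exists_eq_sum_indC (indC L₀ hL₀ y₀) L hL (by
      intro x l hl
      by_cases hx : x - y₀ ∈ L₀
      · rw [indC_apply_of_mem hL₀ hx, indC_apply_of_mem hL₀]
        rw [add_sub_right_comm]
        exact add_mem hx (hLL₀ l hl)
      · rw [indC_apply_of_notMem hL₀ hx, indC_apply_of_notMem hL₀]
        rw [add_sub_right_comm]
        exact fun h' => hx (by simpa using sub_mem h' (hLL₀ l hl)))
    have hF' : ∀ y ∈ F, y - y₀ ∈ L₀ := fun y hy => by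
      by_contra hh
      exact hF y hy (indC_apply_of_notMem hL₀ hh)
    rw [hs, map_sum, Finset.sum_congr rfl (g := fun _ => θ (indC L hL y₀))] at h₀
    · rw [Finset.sum_const, smul_eq_zero] at h₀
      refine h₀.resolve_left (Finset.card_ne_zero.2 (hne fun h0 => ?_))
      have := indC_apply_of_mem hL₀ (x := y₀) (y := y₀) (by simp)
      rw [h0] at this
      simp at this
    · intro y hy
      rw [map_smul, indC_apply_of_mem hL₀ (hF' y hy), one_smul]
      exact hconst _ (hy₀ (hF' y hy)) _ (hy₀ hy₀')
  obtain ⟨F, hF, -, hs⟩ := SchwartzBZ.exists_eq_sum_indC φ L hL fun x l hl => hL₁ x l (hLL₁ l hl)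
  rw [hs, map_sum]
  refine Finset.sum_eq_zero fun y hy => ?_
  rw [map_smul, hconst y (hφ (hF y hy)) y₀ (hy₀ hy₀'), hz, smul_zero]

end Nonarchimedean

section Ultrametric

variable (K : Type*) [NontriviallyNormedField K] [LocallyCompactSpace K]

theorem isUltrametricDist_of_totallyDisconnected [TotallyDisconnectedSpace K] :
    IsUltrametricDist K := by
  obtain ⟨C, hC, -, hCc⟩ := local_compact_nhds (univ_mem : univ ∈ 𝓝 (0 : K))
  obtain ⟨W, hW, h0, hWC⟩ := loc_compact_Haus_tot_disc_of_zero_dim.exists_subset_of_mem_open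
    (mem_interior_iff_mem_nhds.2 hC) isOpen_interior
  have hWc : IsCompact W := hCc.of_isClosed_subset hW.isClosed (hWC.trans interior_subset)
  obtain ⟨V, hV, hWV⟩ := compact_open_separated_add_right hWc hW.isOpen subset_rfl
  obtain ⟨r, hr, hrV⟩ := Metric.mem_nhds_iff.1 hV
  obtain ⟨h, h1, h2⟩ := NormedField.exists_norm_lt K hr
  have hhV : h ∈ V := hrV (by simpa using h2)
  have hmem : ∀ n : ℕ, n • h ∈ W := by
    intro n
    induction n with
    | zero => simpa using h0
    | succ n ih =>
      rw [succ_nsmul]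
      exact hWV (add_mem_add ih hhV)
  obtain ⟨R, hR⟩ := hWc.isBounded.exists_norm_le
  refine IsUltrametricDist.isUltrametricDist_of_forall_norm_natCast_le_one fun n => ?_
  by_contra! hn
  obtain ⟨k, hk⟩ := ((tendsto_pow_atTop_atTop_of_one_lt hn).eventually_gt_atTop
    (R / ‖h‖)).exists
  have := hR _ (hmem (n ^ k))
  rw [nsmul_eq_mul, norm_mul, Nat.cast_pow, norm_pow, ← le_div_iff₀ h1] at this
  exact absurd this (not_le.2 hk)

end Ultrametric

section Lattice

variable {K : Type*} [NontriviallyNormedField K] [IsUltrametricDist K]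
  {ι κ : Type*} [Fintype ι] [Fintype κ]

/-- The lattice of matrices with all entries of norm at most `ε`. -/
def matLat (K : Type*) [NontriviallyNormedField K] [IsUltrametricDist K]
    (ι κ : Type*) [Fintype ι] [Fintype κ] (ε : ℝ) (hε : 0 < ε) :
    OpenAddSubgroup (Matrix ι κ K) where
  carrier := {x | ∀ i j, ‖x i j‖ ≤ ε}
  add_mem' hx hy i j := (IsUltrametricDist.norm_add_le_max _ _).trans (max_le (hx i j) (hy i j))
  zero_mem' := by simp [hε.le]
  neg_mem' hx i j := by simpa using hx i j
  isOpen' := by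
    have : {x : Matrix ι κ K | ∀ i j, ‖x i j‖ ≤ ε}
        = ⋂ i, ⋂ j, (fun x : Matrix ι κ K => x i j) ⁻¹' Metric.closedBall 0 ε := by
      ext x
      simp
    change IsOpen {x : Matrix ι κ K | ∀ i j, ‖x i j‖ ≤ ε}
    rw [this]
    exact isOpen_iInter_of_finite fun i => isOpen_iInter_of_finite fun j =>
      (IsUltrametricDist.isOpen_closedBall 0 hε.ne').preimage (by fun_prop)

@[simp] theorem mem_matLat {ε : ℝ} {hε : 0 < ε} {x : Matrix ι κ K} :
    x ∈ matLat K ι κ ε hε ↔ ∀ i j, ‖x i j‖ ≤ ε := Iff.rfl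

theorem exists_matLat_subset {U : Set (Matrix ι κ K)} (hU : U ∈ 𝓝 0) :
    ∃ ε₀ > 0, ∀ ε, ∀ hε : 0 < ε, ε ≤ ε₀ → (matLat K ι κ ε hε : Set (Matrix ι κ K)) ⊆ U := by
  have hU' : U ∈ 𝓝 (0 : ι → κ → K) := hU
  obtain ⟨ε, hε, h⟩ := Metric.nhds_basis_closedBall.mem_iff.1 hU'
  refine ⟨ε, hε, fun ε' hε' hle x hx => h ?_⟩
  refine (dist_pi_le_iff hε.le).2 fun i => (dist_pi_le_iff hε.le).2 fun j => ?_
  simpa using (hx i j).trans hle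

instance : NonarchimedeanAddGroup (Matrix ι κ K) where
  is_nonarchimedean U hU := by
    obtain ⟨ε, hε, h⟩ := exists_matLat_subset hU
    exact ⟨_, h ε hε le_rfl⟩

theorem isCompact_matLat [LocallyCompactSpace K] (ε : ℝ) (hε : 0 < ε) :
    IsCompact (matLat K ι κ ε hε : Set (Matrix ι κ K)) := by
  have : ProperSpace K := ProperSpace.of_locallyCompactSpace K
  have h : IsCompact (Set.univ.pi fun _ : ι => Set.univ.pi fun _ : κ =>
      Metric.closedBall (0 : K) ε) :=
    isCompact_univ_pi fun _ => isCompact_univ_pi fun _ => isCompact_closedBall _ _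
  change @IsCompact (ι → κ → K) _ {x | ∀ i j, ‖x i j‖ ≤ ε}
  convert h
  ext x
  simp [Set.mem_pi]

instance [LocallyCompactSpace K] : LocallyCompactSpace (Matrix ι κ K) :=
  inferInstanceAs (LocallyCompactSpace (ι → κ → K))

instance [TotallyDisconnectedSpace K] : TotallyDisconnectedSpace (Matrix ι κ K) :=
  inferInstanceAs (TotallyDisconnectedSpace (ι → κ → K))

end Lattice

section GeneralLinear

variable {K : Type*} [Field K] {ι : Type*} [Fintype ι] [DecidableEq ι]

/-- A transvection as an element of the general linear group. -/
noncomputable def transvU (i j : ι) (h : i ≠ j) (c : K) : GL ι K :=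
  Matrix.GeneralLinearGroup.mkOfDetNeZero (transvection i j c)
    (by simp [det_transvection_of_ne _ _ h])

@[simp] theorem coe_transvU (i j : ι) (h : i ≠ j) (c : K) :
    (transvU i j h c : Matrix ι ι K) = transvection i j c := rfl

/-- The diagonal matrix with unit entries `v`, as an element of the general linear group. -/
def diagU : (ι → Kˣ) →* GL ι K :=
  (Units.map (Matrix.diagonalRingHom ι K : (ι → K) →* Matrix ι ι K)).comp
    MulEquiv.piUnits.symm.toMonoidHom

@[simp] theorem coe_diagU (v : ι → Kˣ) :
    (diagU v : Matrix ι ι K) = diagonal fun i => (v i : K) := rfl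

theorem det_diagU (v : ι → Kˣ) : Matrix.GeneralLinearGroup.det (diagU v) = ∏ i, v i := by
  ext
  simp

theorem weyl_mul_diagonal {i j : ι} (h : i ≠ j) (a : K) :
    (transvection i j 1 * transvection j i (-1) * transvection i j 1 : Matrix ι ι K)
        * diagonal (Function.update 1 j a)
      = diagonal (Function.update 1 i a) *
        (transvection i j 1 * transvection j i (-1) * transvection i j 1) := by
  have hw : (transvection i j 1 * transvection j i (-1) * transvection i j 1 : Matrix ι ι K)
      = 1 - single i i 1 - single j j 1 + single i j 1 - single j i 1 := by
    simp [transvection, mul_add, add_mul, h.symm, ← single_neg]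
    abel
  rw [hw]
  ext p q
  rw [mul_diagonal, diagonal_mul]
  by_cases hp : p = i <;> by_cases hp' : p = j <;> by_cases hq : q = i <;> by_cases hq' : q = j <;>
    by_cases hpq : p = q <;> subst_vars <;>
    simp_all [Function.update, one_apply, Ne.symm h, eq_comm]

theorem GL_hom_eq {Q : Type*} [Monoid Q] (f : GL ι K →* Q)
    (hf : ∀ i j h c, f (transvU i j h c) = 1) (i : ι) (g : GL ι K) :
    f g = f (diagU (Pi.mulSingle i (Matrix.GeneralLinearGroup.det g))) := by
  have hswap : ∀ (j : ι) (a : Kˣ), f (diagU (Pi.mulSingle j a)) = f (diagU (Pi.mulSingle i a)) := by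
    intro j a
    rcases eq_or_ne i j with rfl | h
    · rfl
    · have hc : ∀ l : ι, (fun p => ((Pi.mulSingle l a : ι → Kˣ) p : K))
          = Function.update (1 : ι → K) l (a : K) := by
        intro l
        ext p
        by_cases hp : p = l
        · subst hp; simp
        · simp [hp]
      have e : (transvU i j h (1 : K) * transvU j i h.symm (-1) * transvU i j h 1)
          * diagU (Pi.mulSingle j a) = diagU (Pi.mulSingle i a) *
            (transvU i j h (1 : K) * transvU j i h.symm (-1) * transvU i j h 1) := by
        apply Units.ext
        simp only [Units.val_mul, coe_transvU, coe_diagU, hc]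
        exact weyl_mul_diagonal h _
      simpa [hf] using congrArg f e
  have hdiag : ∀ v : ι → Kˣ, f (diagU v) = f (diagU (Pi.mulSingle i (∏ j, v j))) := by
    intro v
    induction v using Pi.mulSingle_induction with
    | one => simp
    | mul v w hv hw =>
      simp only [map_mul, Pi.mul_apply, Finset.prod_mul_distrib, Pi.mulSingle_mul, hv, hw]
    | mulSingle j a =>
      rw [hswap]
      simp
  have main : ∀ M : Matrix ι ι K, M.det ≠ 0 → ∀ g : GL ι K, (g : Matrix ι ι K) = M →
      f g = f (diagU (Pi.mulSingle i (Matrix.GeneralLinearGroup.det g))) := by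
    intro M hM
    refine diagonal_transvection_induction_of_det_ne_zero (fun M => ∀ g : GL ι K,
      (g : Matrix ι ι K) = M → f g = f (diagU (Pi.mulSingle i (Matrix.GeneralLinearGroup.det g))))
      M hM ?_ ?_ ?_
    · intro D hD g hg
      rw [det_diagonal, Finset.prod_ne_zero_iff] at hD
      obtain rfl : g = diagU fun j => Units.mk0 (D j) (hD j (Finset.mem_univ _)) :=
        Units.ext (by simpa using hg)
      rw [det_diagU]
      exact hdiag _
    · intro t g hg
      obtain rfl : g = transvU t.i t.j t.hij t.c := Units.ext hg
      have : Matrix.GeneralLinearGroup.det (transvU t.i t.j t.hij t.c) = 1 := by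
        ext
        simp [det_transvection_of_ne _ _ t.hij]
      rw [this, hf]
      simp
    · intro A B hA hB ihA ihB g hg
      obtain rfl : g = Matrix.GeneralLinearGroup.mkOfDetNeZero A hA *
        Matrix.GeneralLinearGroup.mkOfDetNeZero B hB := Units.ext hg
      simp only [map_mul, Pi.mulSingle_mul]
      rw [ihA (.mkOfDetNeZero A hA) rfl, ihB (.mkOfDetNeZero B hB) rfl]
  exact main _ (by
    have := (Matrix.GeneralLinearGroup.det g).ne_zero
    simpa using this) g rfl

theorem diagU_mul_transvU [NeZero (2 : K)] (i j : ι) (h : i ≠ j) (c : K) :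
    diagU (Pi.mulSingle i (Units.mk0 2 two_ne_zero)) * transvU i j h c
      = transvU i j h c * transvU i j h c * diagU (Pi.mulSingle i (Units.mk0 2 two_ne_zero)) := by
  apply Units.ext
  simp only [Units.val_mul, coe_transvU, coe_diagU, transvection_mul_transvection_same _ _ h]
  ext p q
  rw [mul_diagonal, diagonal_mul]
  by_cases hp : p = i <;> by_cases hq : q = j <;> by_cases hpq : p = q <;> subst_vars <;>
    simp_all [transvection, one_apply, two_mul, eq_comm]

end GeneralLinear

section Unipotent

variable {G V : Type*} [Group G] [AddCommGroup V] [Module ℂ V] (ρ : G →* Module.End ℂ V)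

/-- The vectors killed by all products of `k` operators of the form `ρ g - 1`. -/
def genFix : ℕ → Submodule ℂ V
  | 0 => ⊥
  | k + 1 => ⨅ g, (genFix k).comap (ρ g - 1)

theorem mem_genFix_succ {k : ℕ} {v : V} :
    v ∈ genFix ρ (k + 1) ↔ ∀ g, ρ g v - v ∈ genFix ρ k := by
  simp [genFix]

theorem apply_mem_genFix (k : ℕ) : ∀ (g : G) (v : V), v ∈ genFix ρ k → ρ g v ∈ genFix ρ k := by
  induction k with
  | zero =>
    intro g v hv
    simp only [genFix, Submodule.mem_bot] at hv ⊢
    simp [hv]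
  | succ k ih =>
    intro g v hv
    rw [mem_genFix_succ] at hv ⊢
    intro h
    have e : ρ h (ρ g v) - ρ g v = ρ g (ρ (g⁻¹ * h * g) v - v) := by
      rw [map_sub, ← Module.End.mul_apply, ← Module.End.mul_apply, ← map_mul, ← map_mul]
      group
    rw [e]
    exact ih _ _ (hv _)

theorem genFix_apply_eq {d u : G} (hdu : d * u = u * u * d) {k : ℕ} {v : V}
    (hv : v ∈ genFix ρ k) : ρ u v = v := by
  have hX : ∀ v, ρ u v - v = (ρ d (ρ u v - v) - (ρ u v - v)) - (ρ u (ρ u v - v) - (ρ u v - v))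
      - (2 : ℕ) • (ρ u (ρ d v - v) - (ρ d v - v))
      - (ρ u (ρ u (ρ d v - v) - (ρ d v - v)) - (ρ u (ρ d v - v) - (ρ d v - v))) := by
    intro v
    have h : ρ d (ρ u v) = ρ u (ρ u (ρ d v)) := by
      simp only [← Module.End.mul_apply, ← map_mul, hdu, mul_assoc]
    simp only [map_sub, h]
    abel
  have key : ∀ j k, ∀ v ∈ genFix ρ (k + j), ρ u v - v ∈ genFix ρ k := by
    intro j
    induction j with
    | zero => exact fun k v hv => sub_mem (apply_mem_genFix ρ _ _ _ hv) hv
    | succ j ih =>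
      intro k v hv
      have h1 : ρ u v - v ∈ genFix ρ (k + 1) := ih (k + 1) v (by rwa [add_right_comm])
      have h2 : ρ d v - v ∈ genFix ρ (k + j) := (mem_genFix_succ ρ).1 hv d
      have h3 := ih k _ h2
      rw [hX]
      exact sub_mem (sub_mem (sub_mem ((mem_genFix_succ ρ).1 h1 _) ((mem_genFix_succ ρ).1 h1 _))
        (nsmul_mem h3 _)) (sub_mem (apply_mem_genFix ρ _ _ _ h3) h3)
  have := key k 0 v (by simpa using hv)
  simpa [genFix, sub_eq_zero] using this

/-- The representation on `genFix ρ k`. -/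
def genFixRep (k : ℕ) : G →* Module.End ℂ (genFix ρ k) where
  toFun g := (ρ g).restrict (apply_mem_genFix ρ k g)
  map_one' := by
    ext v
    simp
  map_mul' g h := by
    ext v
    simp

theorem genFix_apply_eq_of_det {K ι : Type*} [Field K] [NeZero (2 : K)] [Fintype ι] [DecidableEq ι]
    [Nonempty ι] (j : GL ι K →* G) {k : ℕ} {v : V} (hv : v ∈ genFix ρ k) {g : GL ι K}
    (hg : Matrix.GeneralLinearGroup.det g = 1) : ρ (j g) v = v := by
  have h := GL_hom_eq ((genFixRep ρ k).comp j) (by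
    intro a b hab c
    ext w
    have := congrArg j (diagU_mul_transvU a b hab c)
    simp only [map_mul] at this
    simpa [genFixRep] using genFix_apply_eq ρ this w.2) (Classical.arbitrary ι) g
  rw [hg] at h
  have h' := congrArg (fun T : Module.End ℂ (genFix ρ k) => (T ⟨v, hv⟩ : V)) h
  simpa [genFixRep] using h'

end Unipotent

section TranslationInvariant

/-- Integration against a measure which is finite on compact sets. -/
noncomputable def intS {X : Type*} [TopologicalSpace X] [MeasurableSpace X]
    [OpensMeasurableSpace X] (μ : Measure X) [IsFiniteMeasureOnCompacts μ] :
    SchwartzBZ X →ₗ[ℂ] ℂ where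
  toFun φ := ∫ x, (φ : X → ℂ) x ∂μ
  map_add' φ ψ := integral_add
      ((φ.2.1.continuous).integrable_of_hasCompactSupport φ.2.2)
      ((ψ.2.1.continuous).integrable_of_hasCompactSupport ψ.2.2)
  map_smul' c φ := by simpa using integral_smul c (φ : X → ℂ)

theorem intS_indS {X : Type*} [TopologicalSpace X] [MeasurableSpace X]
    [OpensMeasurableSpace X] (μ : Measure X) [IsFiniteMeasureOnCompacts μ] (C : Set X)
    (h : IsClopen C ∧ IsCompact C) : intS μ (indS C h) = (μ.real C : ℂ) := by
  change ∫ x, C.indicator 1 x ∂μ = _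
  have := integral_indicator_const (μ := μ) (1 : ℂ) h.1.isOpen.measurableSet
  simpa [← Pi.one_def] using this

/-- A translation invariant distribution. -/
def TransInv {E : Type*} [AddCommGroup E] [TopologicalSpace E] [IsTopologicalAddGroup E]
    (Λ : SchwartzBZ E →ₗ[ℂ] ℂ) : Prop :=
  ∀ (v : E) (φ : SchwartzBZ E), Λ (pullH (Homeomorph.addRight v) φ) = Λ φ

theorem TransInv.comp_pullH {E E' : Type*} [AddCommGroup E] [TopologicalSpace E]
    [IsTopologicalAddGroup E] [AddCommGroup E'] [TopologicalSpace E'] [IsTopologicalAddGroup E']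
    {Λ : SchwartzBZ E →ₗ[ℂ] ℂ} (h : TransInv Λ) (e : E ≃ₜ E')
    (he : ∀ x y, e (x + y) = e x + e y) : TransInv (Λ ∘ₗ pullH e) := by
  intro v φ
  simp only [LinearMap.comp_apply]
  rw [← h (e.symm v) (pullH e φ)]
  congr 1
  ext x
  simp [he]

theorem transInv_intS {E : Type*} [AddCommGroup E] [TopologicalSpace E] [IsTopologicalAddGroup E]
    [MeasurableSpace E] [BorelSpace E] (μ : Measure E) [μ.IsAddHaarMeasure] :
    TransInv (intS μ) := by
  intro v φ
  exact integral_add_right_eq_self (fun x => (φ : E → ℂ) x) v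

variable {E : Type*} [AddCommGroup E] [TopologicalSpace E] [NonarchimedeanAddGroup E]

theorem TransInv.apply_indC {Λ : SchwartzBZ E →ₗ[ℂ] ℂ} (h : TransInv Λ) (L : OpenAddSubgroup E)
    (hL : IsCompact (L : Set E)) (y y' : E) : Λ (indC L hL y) = Λ (indC L hL y') := by
  rw [← h (y - y') (indC L hL y)]
  congr 1
  ext x
  by_cases hx : x - y' ∈ L
  · rw [indC_apply_of_mem hL hx]
    exact indC_apply_of_mem hL
      (by rwa [Homeomorph.coe_addRight, add_sub_assoc, sub_sub_cancel_left, ← sub_eq_add_neg])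
  · rw [indC_apply_of_notMem hL hx]
    exact indC_apply_of_notMem hL
      (by rwa [Homeomorph.coe_addRight, add_sub_assoc, sub_sub_cancel_left, ← sub_eq_add_neg])

theorem TransInv.eq_zero [LocallyCompactSpace E] {Λ : SchwartzBZ E →ₗ[ℂ] ℂ} (h : TransInv Λ)
    {L : OpenAddSubgroup E} {hL : IsCompact (L : Set E)} (h0 : Λ (indC L hL 0) = 0) : Λ = 0 := by
  ext φ
  refine kills_of_indC_const Λ univ (fun U hU => ?_) L hL 0 (subset_univ _) h0 φ (subset_univ _)
  obtain ⟨L', hL', hc⟩ := exists_openAddSubgroup_isCompact hU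
  exact ⟨L', hc, hL', fun y _ y' _ => h.apply_indC _ _ _ _⟩

theorem TransInv.exists_eq_smul [LocallyCompactSpace E] {Λ Λ' : SchwartzBZ E →ₗ[ℂ] ℂ}
    (h : TransInv Λ) (h' : TransInv Λ') {L : OpenAddSubgroup E} {hL : IsCompact (L : Set E)}
    (h0 : Λ (indC L hL 0) ≠ 0) : Λ' = (Λ' (indC L hL 0) / Λ (indC L hL 0)) • Λ := by
  rw [← sub_eq_zero]
  refine TransInv.eq_zero (L := L) (hL := hL) (fun v φ => ?_) ?_
  · simp only [LinearMap.sub_apply, LinearMap.smul_apply, h v, h' v]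
  · simp [h0]

theorem intS_indC_ne_zero [MeasurableSpace E] [BorelSpace E] (μ : Measure E) [μ.IsAddHaarMeasure]
    (L : OpenAddSubgroup E) (hL : IsCompact (L : Set E)) (y : E) : intS μ (indC L hL y) ≠ 0 := by
  rw [indC, intS_indS, Complex.ofReal_ne_zero]
  have h := cosetSet_prop hL y
  exact (ENNReal.toReal_pos (h.1.isOpen.measure_pos μ ⟨y, mem_cosetSet.2 (by simp)⟩).ne'
    h.2.measure_lt_top.ne).ne'

end TranslationInvariant

section Modulus

variable {K : Type*} [NontriviallyNormedField K] {ι κ : Type*} [Fintype ι] [Fintype κ]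
  [DecidableEq ι] [DecidableEq κ]

/-- The homeomorphism `x ↦ g * x * h` of a space of matrices. -/
def actH (g : GL ι K) (h : GL κ K) : Matrix ι κ K ≃ₜ Matrix ι κ K where
  toFun x := (g : Matrix ι ι K) * x * (h : Matrix κ κ K)
  invFun x := (g⁻¹.val : Matrix ι ι K) * x * (h⁻¹.val : Matrix κ κ K)
  left_inv x := by
    beta_reduce
    rw [Matrix.mul_assoc, Matrix.mul_assoc, ← Matrix.mul_assoc _ _ h⁻¹.val,
      Matrix.mul_assoc _ h.val, Units.mul_inv, Matrix.mul_one, ← Matrix.mul_assoc,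
      Units.inv_mul, Matrix.one_mul]
  right_inv x := by
    beta_reduce
    rw [Matrix.mul_assoc, Matrix.mul_assoc, ← Matrix.mul_assoc _ _ h.val,
      Matrix.mul_assoc _ h⁻¹.val, Units.inv_mul, Matrix.mul_one, ← Matrix.mul_assoc,
      Units.mul_inv, Matrix.one_mul]
  continuous_toFun := by fun_prop
  continuous_invFun := by fun_prop

@[simp] theorem actH_apply (g : GL ι K) (h : GL κ K) (x : Matrix ι κ K) :
    actH g h x = (g : Matrix ι ι K) * x * (h : Matrix κ κ K) := rfl

/-- Transposition, as a homeomorphism. -/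
def transposeH : Matrix ι κ K ≃ₜ Matrix κ ι K where
  toFun := transpose
  invFun := transpose
  left_inv := transpose_transpose
  right_inv := transpose_transpose
  continuous_toFun := by fun_prop
  continuous_invFun := by fun_prop

/-- Transposition of invertible matrices. -/
def transposeU (g : GL ι K) : GL ι K where
  val := (g : Matrix ι ι K)ᵀ
  inv := (g⁻¹.val : Matrix ι ι K)ᵀ
  val_inv := by rw [← transpose_mul]; simp
  inv_val := by rw [← transpose_mul]; simp

theorem det_transposeU (g : GL ι K) :
    Matrix.GeneralLinearGroup.det (transposeU g) = Matrix.GeneralLinearGroup.det g :=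
  Units.ext (det_transpose _)

theorem transposeH_actH (g : GL ι K) (h : GL κ K) (x : Matrix ι κ K) :
    transposeH (actH g h x) = actH (transposeU h) (transposeU g) (transposeH x) := by
  change ((g : Matrix ι ι K) * x * (h : Matrix κ κ K))ᵀ
    = (h : Matrix κ κ K)ᵀ * xᵀ * (g : Matrix ι ι K)ᵀ
  rw [transpose_mul, transpose_mul, Matrix.mul_assoc]

variable [IsUltrametricDist K] [LocallyCompactSpace K]

theorem exists_transInv_diagU [MeasurableSpace K] [BorelSpace K] (μK : Measure K)
    [μK.IsAddHaarMeasure]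
    (hnormed : ∀ a : K, a ≠ 0 → ∀ s : Set K, MeasurableSet s →
      μK ((a * ·) '' s) = ENNReal.ofReal ‖a‖ * μK s) :
    ∃ Λ : SchwartzBZ (Matrix ι κ K) →ₗ[ℂ] ℂ, TransInv Λ ∧ (∀ L hL y, Λ (indC L hL y) ≠ 0) ∧
      ∀ v : ι → Kˣ,
        Λ (pullH (actH (diagU v) 1) (indC (matLat K ι κ 1 one_pos) (isCompact_matLat 1 one_pos) 0))
        = (‖((∏ i, v i : Kˣ) : K)‖ ^ (-(Fintype.card κ : ℤ)) : ℝ) *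
          Λ (indC (matLat K ι κ 1 one_pos) (isCompact_matLat 1 one_pos) 0) := by
  have : ProperSpace K := ProperSpace.of_locallyCompactSpace K
  let ν : Measure (ι × κ → K) := Measure.pi fun _ => μK
  let T : (ι × κ → K) ≃ₜ Matrix ι κ K :=
    { toFun := fun f => Matrix.of fun i j => f (i, j)
      invFun := fun x p => x p.1 p.2
      left_inv := fun f => rfl
      right_inv := fun x => rfl
      continuous_toFun := continuous_matrix fun i j => continuous_apply (i, j)
      continuous_invFun := by fun_prop }
  have hT : ∀ (C : Set (Matrix ι κ K)) (h : IsClopen C ∧ IsCompact C),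
      intS ν (pullH T (indS C h)) = (ν.real (T ⁻¹' C) : ℂ) := fun C h =>
    intS_indS ν _ ⟨h.1.preimage T.continuous, T.isCompact_preimage.2 h.2⟩
  refine ⟨intS ν ∘ₗ pullH T, (transInv_intS ν).comp_pullH T fun x y => rfl, ?_, fun v => ?_⟩
  · intro L hL y
    have h := cosetSet_prop hL y
    rw [LinearMap.comp_apply, indC, hT, Complex.ofReal_ne_zero]
    exact (ENNReal.toReal_pos ((h.1.isOpen.preimage T.continuous).measure_pos ν
      ⟨T.symm y, by simp [mem_cosetSet]⟩).ne'
      (T.isCompact_preimage.2 h.2).measure_lt_top.ne).ne'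
  have hball : ∀ a : Kˣ, μK.real {y : K | ‖(a : K) * y‖ ≤ 1}
      = ‖(a : K)‖⁻¹ * μK.real (Metric.closedBall 0 1) := by
    intro a
    have hm : MeasurableSet {y : K | ‖(a : K) * y‖ ≤ 1} :=
      (isClosed_le (by fun_prop) continuous_const).measurableSet
    have := hnormed a a.ne_zero _ hm
    have e : ((a : K) * ·) '' {y : K | ‖(a : K) * y‖ ≤ 1} = Metric.closedBall 0 1 := by
      ext y
      constructor
      · rintro ⟨z, hz, rfl⟩
        simpa using hz
      · intro hy
        exact ⟨(a : K)⁻¹ * y, by simpa using hy, by simp⟩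
    rw [e] at this
    rw [measureReal_def, measureReal_def, this, ENNReal.toReal_mul, ENNReal.toReal_ofReal
      (norm_nonneg _), inv_mul_cancel_left₀ (norm_ne_zero_iff.2 a.ne_zero)]
  have hS : ∀ w : ι → Kˣ, intS ν (pullH T (pullH (actH (diagU w) 1)
      (indC (matLat K ι κ 1 one_pos) (isCompact_matLat 1 one_pos) 0)))
      = (∏ i, (‖(w i : K)‖⁻¹ * μK.real (Metric.closedBall 0 1)) ^ Fintype.card κ : ℝ) := by
    intro w
    have hcl := (cosetSet_prop (isCompact_matLat (K := K) (ι := ι) (κ := κ) 1 one_pos) 0)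
    have e : T ⁻¹' (actH (diagU w) 1 ⁻¹' (cosetSet (matLat K ι κ 1 one_pos) 0))
        = Set.univ.pi fun p => {y : K | ‖(w p.1 : K) * y‖ ≤ 1} := by
      ext x
      have hTx : ∀ i j, T x i j = x (i, j) := fun _ _ => rfl
      simp [mem_cosetSet, diagonal_mul, hTx, Set.mem_pi]
    have h := hT _ ⟨hcl.1.preimage (actH (diagU w) (1 : GL κ K)).continuous,
      (actH (diagU w) (1 : GL κ K)).isCompact_preimage.2 hcl.2⟩
    refine h.trans ?_
    rw [e, measureReal_def, Measure.pi_pi, ENNReal.toReal_prod]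
    simp only [← measureReal_def, hball, Fintype.prod_prod_type, Finset.prod_const,
      Finset.card_univ]
  have h1 : pullH (actH (diagU (1 : ι → Kˣ)) (1 : GL κ K))
      (indC (matLat K ι κ 1 one_pos) (isCompact_matLat 1 one_pos) 0)
      = indC (matLat K ι κ 1 one_pos) (isCompact_matLat 1 one_pos) 0 := by
    ext x
    simp
  simp only [LinearMap.comp_apply]
  rw [hS, ← h1, hS, ← Complex.ofReal_mul]
  congr 1
  simp only [mul_pow, Finset.prod_mul_distrib, Pi.one_apply, Units.val_one, norm_one, inv_one,
    one_mul, Units.coe_prod, norm_prod, Finset.prod_pow,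
    Finset.prod_inv_distrib, _root_.zpow_neg, zpow_natCast, inv_pow]

/-- The modulus of left multiplication on a space of matrices. -/
theorem TransInv.apply_left [CharZero K] [Nonempty ι] [MeasurableSpace K] [BorelSpace K]
    (μK : Measure K) [μK.IsAddHaarMeasure]
    (hnormed : ∀ a : K, a ≠ 0 → ∀ s : Set K, MeasurableSet s →
      μK ((a * ·) '' s) = ENNReal.ofReal ‖a‖ * μK s)
    {Λ' : SchwartzBZ (Matrix ι κ K) →ₗ[ℂ] ℂ} (hΛ' : TransInv Λ') (g : GL ι K)
    (φ : SchwartzBZ (Matrix ι κ K)) :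
    Λ' (pullH (actH g 1) φ)
      = (‖(g : Matrix ι ι K).det‖ ^ (-(Fintype.card κ : ℤ)) : ℝ) * Λ' φ := by
  obtain ⟨Λ, hΛ, hne, hdiag⟩ := exists_transInv_diagU (ι := ι) (κ := κ) μK hnormed
  set B := indC (matLat K ι κ 1 one_pos) (isCompact_matLat 1 one_pos) 0 with hB
  have hex : ∀ g : GL ι K, Λ ∘ₗ pullH (actH g 1) = (Λ (pullH (actH g 1) B) / Λ B) • Λ :=
    fun g => hΛ.exists_eq_smul (hΛ.comp_pullH _ fun x y => by simp [Matrix.mul_add]) (hne _ _ _)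
  have hcomp : ∀ (g h : GL ι K) (φ : SchwartzBZ (Matrix ι κ K)),
      pullH (actH (g * h) (1 : GL κ K)) φ
        = pullH (actH h 1) (pullH (actH g 1) φ) := by
    intro g h φ
    ext x
    simp [Matrix.mul_assoc]
  let f : GL ι K →* ℂ :=
    { toFun := fun g => Λ (pullH (actH g 1) B) / Λ B
      map_one' := by
        have : pullH (actH (1 : GL ι K) (1 : GL κ K)) B = B := by
          ext x
          simp
        rw [this, div_self (hne _ _ _)]
      map_mul' := fun g h => by
        have := LinearMap.congr_fun (hex h) (pullH (actH g 1) B)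
        rw [hcomp]
        simp only [LinearMap.comp_apply, LinearMap.smul_apply, smul_eq_mul] at this
        rw [this]
        ring }
  have hf : ∀ i j h c, f (transvU i j h c) = 1 := by
    intro i j h c
    have e := congrArg f (diagU_mul_transvU i j h c)
    rw [map_mul, map_mul, map_mul, mul_comm] at e
    have n1 := ((Group.isUnit (transvU i j h c)).map f).ne_zero
    have n2 := ((Group.isUnit (diagU (Pi.mulSingle i (Units.mk0 (2 : K) two_ne_zero)))).map
      f).ne_zero
    exact mul_left_cancel₀ n1 (by rw [mul_one]; exact (mul_right_cancel₀ n2 e).symm)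
  have key : f g = (‖(g : Matrix ι ι K).det‖ ^ (-(Fintype.card κ : ℤ)) : ℝ) := by
    rw [GL_hom_eq f hf (Classical.arbitrary ι) g]
    change Λ (pullH (actH _ 1) B) / Λ B = _
    rw [hdiag, mul_div_cancel_right₀ _ (hne _ _ _), Finset.prod_pi_mulSingle']
    simp
  rw [hΛ.exists_eq_smul hΛ' (hne (matLat K ι κ 1 one_pos) (isCompact_matLat 1 one_pos) 0)]
  have := LinearMap.congr_fun (hex g) φ
  simp only [LinearMap.comp_apply, LinearMap.smul_apply, smul_eq_mul] at this ⊢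
  rw [this, ← key]
  change _ = Λ (pullH (actH g 1) B) / Λ B * _
  ring

/-- The modulus of left and right multiplication on a space of matrices. -/
theorem TransInv.apply_actH [CharZero K] [Nonempty ι] [Nonempty κ] [MeasurableSpace K]
    [BorelSpace K] (μK : Measure K) [μK.IsAddHaarMeasure]
    (hnormed : ∀ a : K, a ≠ 0 → ∀ s : Set K, MeasurableSet s →
      μK ((a * ·) '' s) = ENNReal.ofReal ‖a‖ * μK s)
    {Λ : SchwartzBZ (Matrix ι κ K) →ₗ[ℂ] ℂ} (hΛ : TransInv Λ) (g : GL ι K) (h : GL κ K)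
    (φ : SchwartzBZ (Matrix ι κ K)) :
    Λ (pullH (actH g h) φ)
      = (‖(g : Matrix ι ι K).det‖ ^ (-(Fintype.card κ : ℤ)) : ℝ) *
        ((‖(h : Matrix κ κ K).det‖ ^ (-(Fintype.card ι : ℤ)) : ℝ) * Λ φ) := by
  have hΛT : TransInv (Λ ∘ₗ pullH transposeH) := hΛ.comp_pullH _ fun x y => rfl
  have h1 := hΛT.apply_left μK hnormed (transposeU h) (pullH transposeH φ)
  have e1 : pullH transposeH (pullH transposeH φ) = φ := rfl
  have e2 : pullH transposeH (pullH (actH (transposeU h) 1) (pullH transposeH φ))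
      = pullH (actH 1 h) φ := by
    ext x
    simp [transposeH, transposeU, transpose_mul]
  have e3 : pullH (actH g 1) (pullH (actH 1 h) φ) = pullH (actH g h) φ := by
    ext x
    simp [Matrix.mul_assoc]
  rw [← e3, hΛ.apply_left μK hnormed, ← e2]
  simp only [LinearMap.comp_apply] at h1
  rw [h1, e1]
  simp [transposeU]

end Modulus

section Shear

theorem mul_vecMulVec_single_apply {K ι κ : Type*} [Field K] [Fintype κ] [DecidableEq κ]
    (x : Matrix ι κ K) (u : κ → K) (j : κ) (p : ι) (q : κ) :
    (x * vecMulVec u (Pi.single j 1)) p q = if q = j then (x *ᵥ u) p else 0 := by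
  rw [mul_vecMulVec, vecMulVec_apply]
  by_cases h : q = j
  · subst h; simp
  · simp [h]

variable {K : Type*} [Field K] {ι κ : Type*} [Fintype ι] [Fintype κ] [DecidableEq ι] [DecidableEq κ]

/-- The unipotent matrix `1 + u eⱼᵀ`, where `u j = 0`. -/
def shearU (u : κ → K) (j : κ) (hu : u j = 0) : GL κ K where
  val := 1 + vecMulVec u (Pi.single j 1)
  inv := 1 - vecMulVec u (Pi.single j 1)
  val_inv := by
    simp [mul_sub, add_mul, vecMulVec_mul_vecMulVec, hu]
  inv_val := by
    simp [mul_add, sub_mul, vecMulVec_mul_vecMulVec, hu]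

theorem coe_shearU (u : κ → K) (j : κ) (hu : u j = 0) :
    (shearU u j hu : Matrix κ κ K) = 1 + vecMulVec u (Pi.single j 1) := rfl

theorem coe_shearU_inv (u : κ → K) (j : κ) (hu : u j = 0) :
    ((shearU u j hu)⁻¹.val : Matrix κ κ K) = 1 - vecMulVec u (Pi.single j 1) := rfl

theorem det_shearU (u : κ → K) (j : κ) (hu : u j = 0) :
    Matrix.GeneralLinearGroup.det (shearU u j hu) = 1 := by
  ext
  have := det_one_add_replicateCol_mul_replicateRow (ι := Unit) u (Pi.single j (1 : K))
  rw [← vecMulVec_eq] at this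
  simp [coe_shearU, this, hu]

end Shear

section SLInvariance

variable {K : Type*} [NontriviallyNormedField K] {ι κ : Type*} [Fintype ι] [Fintype κ]
  [DecidableEq ι] [DecidableEq κ]

/-- Invariance under matrices of determinant one, acting on both sides. -/
def SLInv (η : SchwartzBZ (Matrix ι κ K) →ₗ[ℂ] ℂ) : Prop :=
  ∀ (g : GL ι K) (h : GL κ K), Matrix.GeneralLinearGroup.det g = 1 →
    Matrix.GeneralLinearGroup.det h = 1 → ∀ φ, η (pullH (actH g h) φ) = η φ

theorem SLInv.sub {η η' : SchwartzBZ (Matrix ι κ K) →ₗ[ℂ] ℂ} (h : SLInv η) (h' : SLInv η') :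
    SLInv (η - η') := fun a b ha hb φ => by
  rw [LinearMap.sub_apply, h a b ha hb, h' a b ha hb, LinearMap.sub_apply]

theorem SLInv.smul {η : SchwartzBZ (Matrix ι κ K) →ₗ[ℂ] ℂ} (h : SLInv η) (c : ℂ) :
    SLInv (c • η) := fun a b ha hb φ => by
  rw [LinearMap.smul_apply, h a b ha hb, LinearMap.smul_apply]

theorem SLInv.kills_preimage {η : SchwartzBZ (Matrix ι κ K) →ₗ[ℂ] ℂ} (hη : SLInv η) {g : GL ι K}
    {h : GL κ K} (hg : Matrix.GeneralLinearGroup.det g = 1)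
    (hh : Matrix.GeneralLinearGroup.det h = 1) {W : Set (Matrix ι κ K)} (hW : Kills η W) :
    Kills η (actH g h ⁻¹' W) := by
  intro φ hφ
  have e : pullH (actH g h) (pullH (actH g h).symm φ) = φ := by
    ext x
    simp only [pullH_apply, Homeomorph.symm_apply_apply]
  rw [← e, hη g h hg hh]
  refine hW _ fun x hx => ?_
  have := hφ (show (actH g h).symm x ∈ Function.support (φ : Matrix ι κ K → ℂ) from hx)
  simpa only [mem_preimage, Homeomorph.apply_symm_apply] using this

variable [IsUltrametricDist K] [LocallyCompactSpace K]

theorem SLInv.apply_indC_shear {η : SchwartzBZ (Matrix ι κ K) →ₗ[ℂ] ℂ} (hη : SLInv η) {ε : ℝ}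
    (hε : 0 < ε) (y : Matrix ι κ K) (u : κ → K) (j : κ) (hu : u j = 0) (hu1 : ∀ p, ‖u p‖ ≤ 1) :
    η (indC (matLat K ι κ ε hε) (isCompact_matLat ε hε) (y + y * vecMulVec u (Pi.single j 1)))
      = η (indC (matLat K ι κ ε hε) (isCompact_matLat ε hε) y) := by
  rw [← hη 1 (shearU u j hu) (map_one _) (det_shearU u j hu)]
  congr 1
  have hmul : ∀ z : Matrix ι κ K, z ∈ matLat K ι κ ε hε →
      z * vecMulVec u (Pi.single j 1) ∈ matLat K ι κ ε hε := by
    intro z hz p q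
    rw [mul_vecMulVec_single_apply]
    split_ifs
    · refine IsUltrametricDist.norm_sum_le_of_forall_le_of_nonneg hε.le fun r _ => ?_
      rw [norm_mul]
      exact (mul_le_of_le_one_right (norm_nonneg _) (hu1 r)).trans (hz p r)
    · simpa using hε.le
  have hiff : ∀ x : Matrix ι κ K, actH (1 : GL ι K) (shearU u j hu) x
      - (y + y * vecMulVec u (Pi.single j 1)) ∈ matLat K ι κ ε hε ↔ x - y ∈ matLat K ι κ ε hε := by
    intro x
    have e : actH (1 : GL ι K) (shearU u j hu) x - (y + y * vecMulVec u (Pi.single j 1))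
        = (x - y) * (shearU u j hu : Matrix κ κ K) := by
      simp [coe_shearU, Matrix.mul_add, Matrix.sub_mul]
      abel
    rw [e]
    constructor
    · intro h
      have h2 : x - y = (x - y) * (shearU u j hu : Matrix κ κ K)
          * ((shearU u j hu)⁻¹.val : Matrix κ κ K) := by
        rw [Matrix.mul_assoc, Units.mul_inv, Matrix.mul_one]
      rw [h2, coe_shearU_inv, Matrix.mul_sub, Matrix.mul_one]
      exact sub_mem h (hmul _ h)
    · intro h
      rw [coe_shearU, Matrix.mul_add, Matrix.mul_one]
      exact add_mem h (hmul _ h)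
  ext x
  by_cases hx : x - y ∈ matLat K ι κ ε hε
  · rw [indC_apply_of_mem _ hx, pullH_apply, indC_apply_of_mem _ ((hiff x).2 hx)]
  · rw [indC_apply_of_notMem _ hx, pullH_apply, indC_apply_of_notMem _ (mt (hiff x).1 hx)]

/-- Near a matrix whose columns other than any given one span the whole space, an `SL`-invariant
distribution is locally translation invariant. -/
theorem SLInv.exists_locally_const {η : SchwartzBZ (Matrix ι κ K) →ₗ[ℂ] ℂ} (hη : SLInv η)
    (x₀ : Matrix ι κ K)
    (hx₀ : ∀ j, ∃ σ : ι → κ, (∀ i, σ i ≠ j) ∧ (x₀.submatrix id σ).det ≠ 0) :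
    ∃ δ, ∃ hδ : 0 < δ, ∀ ε, ∀ hε : 0 < ε, ∀ y ∈ cosetSet (matLat K ι κ δ hδ) x₀,
      ∀ y' ∈ cosetSet (matLat K ι κ δ hδ) x₀,
      η (indC (matLat K ι κ ε hε) (isCompact_matLat ε hε) y)
        = η (indC (matLat K ι κ ε hε) (isCompact_matLat ε hε) y') := by
  choose σ hσ hdet using hx₀
  have hev : ∀ j, ∀ᶠ p : Matrix ι κ K × Matrix ι Unit K in 𝓝 (x₀, 0),
      (p.1.submatrix id (σ j)).det ≠ 0 ∧
        ∀ i, ‖((p.1.submatrix id (σ j))⁻¹ * p.2) i ()‖ ≤ 1 := by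
    intro j
    have hc : Continuous fun p : Matrix ι κ K × Matrix ι Unit K => p.1.submatrix id (σ j) :=
      continuous_fst.matrix_submatrix _ _
    refine (hc.matrix_det.continuousAt.eventually_ne (hdet j)).and ?_
    rw [eventually_all]
    intro i
    have hinv : ContinuousAt (fun p : Matrix ι κ K × Matrix ι Unit K =>
        ((p.1.submatrix id (σ j))⁻¹ * p.2)) (x₀, 0) := by
      have h1 : ContinuousAt (fun p : Matrix ι κ K × Matrix ι Unit K =>
        (p.1.submatrix id (σ j))⁻¹) (x₀, 0) := by
        refine ContinuousAt.comp (g := Inv.inv) (continuousAt_matrix_inv _ ?_) hc.continuousAt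
        rw [Ring.inverse_eq_inv']
        exact continuousAt_inv₀ (hdet j)
      have hm : Continuous fun q : Matrix ι ι K × Matrix ι Unit K => q.1 * q.2 := by fun_prop
      exact hm.continuousAt.comp (h1.prodMk continuous_snd.continuousAt)
    have hn : ContinuousAt (fun p : Matrix ι κ K × Matrix ι Unit K =>
        ‖((p.1.submatrix id (σ j))⁻¹ * p.2) i ()‖) (x₀, 0) :=
      (Continuous.continuousAt (f := fun z : Matrix ι Unit K => ‖z i ()‖) (by fun_prop)).comp hinv
    have h0 : ‖((x₀.submatrix id (σ j))⁻¹ * (0 : Matrix ι Unit K)) i ()‖ < 1 := by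
      rw [Matrix.mul_zero]
      simp
    filter_upwards [hn.eventually (gt_mem_nhds h0)] with p hp using le_of_lt hp
  have hev' := eventually_all.2 hev
  rw [nhds_prod_eq] at hev'
  obtain ⟨P, hP, Q, hQ, hPQ⟩ := eventually_prod_iff.1 hev'
  have hP' : ∀ᶠ z : Matrix ι κ K in 𝓝 0, P (x₀ + z) := by
    have : Tendsto (fun z : Matrix ι κ K => x₀ + z) (𝓝 0) (𝓝 x₀) := by
      have : Continuous fun z : Matrix ι κ K => x₀ + z := by fun_prop
      simpa using this.tendsto 0
    exact this hP
  obtain ⟨δ₁, hδ₁, h₁⟩ := exists_matLat_subset hP'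
  obtain ⟨δ₂, hδ₂, h₂⟩ := exists_matLat_subset hQ
  refine ⟨min δ₁ δ₂, lt_min hδ₁ hδ₂, fun ε hε y hy y' hy' => ?_⟩
  have hstep : ∀ y ∈ cosetSet (matLat K ι κ (min δ₁ δ₂) (lt_min hδ₁ hδ₂)) x₀, ∀ (j : κ)
      (v : ι → K), (∀ i, ‖v i‖ ≤ min δ₁ δ₂) →
      η (indC (matLat K ι κ ε hε) (isCompact_matLat ε hε)
        (Matrix.of fun i k => if k = j then y i k + v i else y i k))
        = η (indC (matLat K ι κ ε hε) (isCompact_matLat ε hε) y) := by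
    intro y hy j v hv
    have hPy : P y := by
      have := h₁ _ (lt_min hδ₁ hδ₂) (min_le_left _ _) hy
      simpa using this
    have hQv : Q (Matrix.of fun i _ => v i) := h₂ _ (lt_min hδ₁ hδ₂) (min_le_right _ _)
      fun i _ => hv i
    obtain ⟨hd, hb⟩ := hPQ hPy hQv j
    set c := (y.submatrix id (σ j))⁻¹ * (Matrix.of fun i (_ : Unit) => v i) with hc
    have hMc : (y.submatrix id (σ j)) * c = Matrix.of fun i (_ : Unit) => v i := by
      rw [hc, mul_nonsing_inv_cancel_left _ _ (isUnit_iff_ne_zero.2 hd)]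
    let u : κ → K := fun p => ∑ i, if σ j i = p then c i () else 0
    have hyu : ∀ i, (y *ᵥ u) i = v i := by
      intro i
      have := congrFun (congrFun hMc i) ()
      simp only [Matrix.mul_apply, submatrix_apply, id, of_apply] at this
      rw [← this]
      simp only [mulVec, dotProduct, u, Finset.mul_sum, mul_ite, mul_zero]
      rw [Finset.sum_comm]
      simp
    rw [← hη.apply_indC_shear hε y u j]
    · congr 2
      ext i k
      rw [Matrix.add_apply, mul_vecMulVec_single_apply, hyu]
      by_cases hk : k = j <;> simp [hk]
    · exact Finset.sum_eq_zero fun i _ => if_neg (hσ j i)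
    · intro p
      refine IsUltrametricDist.norm_sum_le_of_forall_le_of_nonneg zero_le_one fun i _ => ?_
      split_ifs
      · exact hb i
      · simp
  have hS : ∀ S : Finset κ, η (indC (matLat K ι κ ε hε) (isCompact_matLat ε hε)
        (Matrix.of fun i k => if k ∈ S then y' i k else y i k))
        = η (indC (matLat K ι κ ε hε) (isCompact_matLat ε hε) y) := by
    intro S
    induction S using Finset.induction_on with
    | empty => congr 2
    | insert j S hj ih =>
      rw [← ih, ← hstep (Matrix.of fun i k => if k ∈ S then y' i k else y i k) ?_ j
        (fun i => y' i j - y i j) ?_]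
      · congr 2
        ext i k
        by_cases hk : k = j
        · subst hk
          simp [hj]
        · simp [hk]
      · intro i k
        by_cases hk : k ∈ S
        · simpa [hk] using hy' i k
        · simpa [hk] using hy i k
      · intro i
        have : (y' - x₀) - (y - x₀) ∈ matLat K ι κ _ (lt_min hδ₁ hδ₂) := sub_mem hy' hy
        simpa using this i j
  rw [← hS Finset.univ]
  congr 2
  ext i k
  simp

end SLInvariance

section FullRank

theorem exists_equiv_sum {ι κ β : Type*} [Fintype ι] [Fintype κ] [Fintype β]
    (hcard : Fintype.card κ = Fintype.card ι + Fintype.card β) {σ : ι → κ}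
    (hσ : Function.Injective σ) : ∃ e : ι ⊕ β ≃ κ, ∀ i, e (Sum.inl i) = σ i := by
  classical
  have hc : Fintype.card β = Fintype.card ((range σ)ᶜ : Set κ) := by
    rw [Fintype.card_compl_set, Set.card_range_of_injective hσ, hcard]
    omega
  refine ⟨(Equiv.sumCongr (Equiv.ofInjective σ hσ) (Fintype.equivOfCardEq hc)).trans
    (Equiv.Set.sumCompl (range σ)), fun i => by simp⟩

theorem injective_of_det_submatrix_ne_zero {K ι κ : Type*} [Field K] {r : Type*} [Fintype r]
    [DecidableEq r]
    {x : Matrix ι κ K} {τ : r → ι} {σ : r → κ} (h : (x.submatrix τ σ).det ≠ 0) :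
    Function.Injective τ ∧ Function.Injective σ := by
  constructor
  · intro a b hab
    by_contra hne
    exact h (det_zero_of_row_eq hne (by ext; simp [hab]))
  · intro a b hab
    by_contra hne
    exact h (det_zero_of_column_eq hne (by simp [hab]))

variable {K : Type*} [Field K] {ι κ : Type*} [Fintype ι] [Fintype κ] [DecidableEq ι] [DecidableEq κ]

/-- Matrices with a nonzero maximal minor form a single orbit under right multiplication by
matrices of determinant one. -/
theorem exists_mul_eq_of_det_ne_zero {x y : Matrix ι κ K} {σ τ : ι → κ}
    (hcard : Fintype.card ι < Fintype.card κ) (hx : (x.submatrix id σ).det ≠ 0)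
    (hy : (y.submatrix id τ).det ≠ 0) :
    ∃ h : GL κ K, Matrix.GeneralLinearGroup.det h = 1 ∧ x * (h : Matrix κ κ K) = y := by
  have hcard' : Fintype.card κ =
      Fintype.card ι + Fintype.card (Fin (Fintype.card κ - Fintype.card ι)) := by
    simp; omega
  let β := Fin (Fintype.card κ - Fintype.card ι)
  let b₀ : β := ⟨0, by omega⟩
  obtain ⟨e₀, -⟩ := exists_equiv_sum hcard' (injective_of_det_submatrix_ne_zero hx).2
  let J : Matrix ι κ K := (fromCols 1 (0 : Matrix ι β K)).submatrix id e₀.symm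
  have key : ∀ (x : Matrix ι κ K) (σ : ι → κ), (x.submatrix id σ).det ≠ 0 →
      ∃ h : GL κ K, Matrix.GeneralLinearGroup.det h = 1 ∧ J * (h : Matrix κ κ K) = x := by
    intro x σ hx
    obtain ⟨e, he⟩ := exists_equiv_sum hcard' (injective_of_det_submatrix_ne_zero hx).2
    let H : Matrix (ι ⊕ β) (ι ⊕ β) K := fromBlocks (x.submatrix id (e ∘ Sum.inl))
      (x.submatrix id (e ∘ Sum.inr)) 0 1
    have hH : IsUnit H := by
      rw [Matrix.isUnit_iff_isUnit_det]
      have : e ∘ Sum.inl = σ := funext he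
      simp only [H, this]
      rw [det_fromBlocks_zero₂₁, det_one, mul_one]
      exact isUnit_iff_ne_zero.2 hx
    obtain ⟨g, hg⟩ := (isUnit_submatrix_equiv e₀.symm e.symm).2 hH
    have hJg : J * (g : Matrix κ κ K) = x := by
      rw [hg, submatrix_mul_equiv, fromCols_mul_fromBlocks]
      ext i k
      obtain ⟨k, rfl⟩ := e.surjective k
      rcases k with k | k <;> simp
    let d : GL κ K := diagU (Pi.mulSingle (e₀ (Sum.inr b₀)) (Matrix.GeneralLinearGroup.det g)⁻¹)
    have hJd : J * (d : Matrix κ κ K) = J := by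
      ext i k
      obtain ⟨k, rfl⟩ := e₀.surjective k
      simp only [d, coe_diagU, mul_diagonal, J, submatrix_apply, Equiv.symm_apply_apply, id]
      by_cases hk : k = Sum.inr b₀
      · subst hk
        simp
      · rw [Pi.mulSingle_eq_of_ne (by simpa using hk)]
        simp
    refine ⟨d * g, ?_, ?_⟩
    · simp [d, det_diagU]
    · rw [Units.val_mul, ← Matrix.mul_assoc, hJd, hJg]
  obtain ⟨h, hh, hx'⟩ := key x σ hx
  obtain ⟨k, hk, hy'⟩ := key y τ hy
  refine ⟨h⁻¹ * k, by simp [hh, hk], ?_⟩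
  rw [← hx', Units.val_mul, Matrix.mul_assoc, ← Matrix.mul_assoc _ _ k.val, Units.mul_inv,
    Matrix.one_mul, hy']

end FullRank

section OpenOrbit

variable {K : Type*} [NontriviallyNormedField K] [CharZero K]

theorem exists_spanning_columns {m n : ℕ} (hmn : m < n) :
    ∃ x₀ : Matrix (Fin m) (Fin n) K, ∀ j, ∃ σ : Fin m → Fin n, (∀ i, σ i ≠ j) ∧
      (x₀.submatrix id σ).det ≠ 0 := by
  obtain ⟨n, rfl⟩ : ∃ n', n = n' + 1 := ⟨n - 1, by omega⟩
  refine ⟨Matrix.of fun i k => (k.val : K) ^ (i : ℕ), fun j =>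
    ⟨fun i => j.succAbove (Fin.castLE (by omega) i), fun i => Fin.succAbove_ne _ _, ?_⟩⟩
  have : (Matrix.of fun (i : Fin m) (k : Fin (n + 1)) => (k.val : K) ^ (i : ℕ)).submatrix id
      (fun i => j.succAbove (Fin.castLE (by omega) i))
      = (vandermonde fun i : Fin m =>
        ((j.succAbove (Fin.castLE (by omega : m ≤ n) i)).val : K))ᵀ := by
    ext i k
    simp [vandermonde_apply]
  rw [this, det_transpose, det_vandermonde_ne_zero_iff]
  intro a b hab
  exact Fin.castLE_injective _ (Fin.succAbove_right_injective (Fin.val_injective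
    (Nat.cast_injective hab)))

variable [IsUltrametricDist K] [LocallyCompactSpace K] [TotallyDisconnectedSpace K]

/-- On the open orbit, an `SL`-invariant distribution is a multiple of a Haar measure. -/
theorem SLInv.exists_kills_full_rank {m n : ℕ} (hmn : m < n)
    {η Λ : SchwartzBZ (Matrix (Fin m) (Fin n) K) →ₗ[ℂ] ℂ} (hη : SLInv η) (hΛ : SLInv Λ)
    (hΛt : TransInv Λ) (hΛ0 : ∀ L hL y, Λ (indC L hL y) ≠ 0) :
    ∃ c : ℂ, Kills (η - c • Λ) {x | ∃ σ : Fin m → Fin n, (x.submatrix id σ).det ≠ 0} := by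
  obtain ⟨x₀, hx₀⟩ := exists_spanning_columns (K := K) hmn
  obtain ⟨δ, hδ, hloc⟩ := hη.exists_locally_const x₀ hx₀
  obtain ⟨c, hc⟩ : ∃ c, η (indC _ (isCompact_matLat δ hδ) x₀)
      = c * Λ (indC _ (isCompact_matLat δ hδ) x₀) := ⟨_, (div_mul_cancel₀ _ (hΛ0 _ _ _)).symm⟩
  have hθ : SLInv (η - c • Λ) := hη.sub (hΛ.smul c)
  have hkill : Kills (η - c • Λ) (cosetSet (matLat K (Fin m) (Fin n) δ hδ) x₀) := by
    refine kills_of_indC_const _ _ (fun U hU => ?_) _ (isCompact_matLat δ hδ) x₀ Subset.rfl ?_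
    · obtain ⟨ε, hε, h⟩ := exists_matLat_subset hU
      refine ⟨_, isCompact_matLat ε hε, h ε hε le_rfl, fun y hy y' hy' => ?_⟩
      rw [LinearMap.sub_apply, LinearMap.sub_apply, LinearMap.smul_apply, LinearMap.smul_apply,
        hloc ε hε y hy y' hy', hΛt.apply_indC _ _ y y']
    · rw [LinearMap.sub_apply, LinearMap.smul_apply, hc, smul_eq_mul, sub_self]
  have hC := cosetSet_prop (L := matLat K (Fin m) (Fin n) δ hδ) (isCompact_matLat δ hδ) x₀
  have hU := kills_iUnion
    (W := fun h : {h : GL (Fin n) K // Matrix.GeneralLinearGroup.det h = 1} =>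
      actH (1 : GL (Fin m) K) h.1 ⁻¹' cosetSet (matLat K (Fin m) (Fin n) δ hδ) x₀)
    (fun h => hC.1.isOpen.preimage (actH (1 : GL (Fin m) K) h.1).continuous)
    (fun h => hθ.kills_preimage (map_one _) h.2 hkill)
  refine ⟨c, hU.mono ?_⟩
  rintro x ⟨σ, hσ⟩
  obtain ⟨τ, -, hτ⟩ := hx₀ ⟨0, by omega⟩
  obtain ⟨h, hh, hx⟩ := exists_mul_eq_of_det_ne_zero (by simpa using hmn) hσ hτ
  refine mem_iUnion.2 ⟨⟨h, hh⟩, ?_⟩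
  have : actH (1 : GL (Fin m) K) h x = x₀ := by
    rw [actH_apply, Units.val_one, Matrix.one_mul, hx]
  rw [mem_preimage, this, mem_cosetSet, sub_self]
  exact zero_mem _

end OpenOrbit

section BlockCoordinates

section Pack

variable {K R α β : Type*}

/-- The first of the two matrices encoded by a vector. -/
def unpackL (v : Matrix (R × β ⊕ α × R) Unit K) : Matrix R β K :=
  Matrix.of fun i j => v (Sum.inl (i, j)) ()

/-- The second of the two matrices encoded by a vector. -/
def unpackR (v : Matrix (R × β ⊕ α × R) Unit K) : Matrix α R K :=
  Matrix.of fun a i => v (Sum.inr (a, i)) ()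

/-- The vector encoding a pair of matrices. -/
def packLR (b : Matrix R β K) (c : Matrix α R K) : Matrix (R × β ⊕ α × R) Unit K :=
  Matrix.of fun p _ => Sum.elim (fun q => b q.1 q.2) (fun q => c q.1 q.2) p

@[simp] theorem unpackL_packLR (b : Matrix R β K) (c : Matrix α R K) :
    unpackL (packLR b c) = b := rfl

@[simp] theorem unpackR_packLR (b : Matrix R β K) (c : Matrix α R K) :
    unpackR (packLR b c) = c := rfl

@[simp] theorem packLR_unpack (v : Matrix (R × β ⊕ α × R) Unit K) :
    packLR (unpackL v) (unpackR v) = v := by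
  ext p u
  rcases p with p | p <;> rfl

theorem packLR_add [Add K] (b b' : Matrix R β K) (c c' : Matrix α R K) :
    packLR (b + b') (c + c') = packLR b c + packLR b' c' := by
  ext p u
  rcases p with p | p <;> rfl

theorem continuous_packLR [TopologicalSpace K] :
    Continuous fun p : Matrix R β K × Matrix α R K => packLR p.1 p.2 := by
  refine continuous_matrix fun p u => ?_
  rcases p with p | p
  · exact continuous_fst.matrix_elem _ _
  · exact continuous_snd.matrix_elem _ _

theorem continuous_unpackL [TopologicalSpace K] :
    Continuous (unpackL : Matrix (R × β ⊕ α × R) Unit K → Matrix R β K) :=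
  continuous_matrix fun _ _ => continuous_id.matrix_elem _ _

theorem continuous_unpackR [TopologicalSpace K] :
    Continuous (unpackR : Matrix (R × β ⊕ α × R) Unit K → Matrix α R K) :=
  continuous_matrix fun _ _ => continuous_id.matrix_elem _ _

/-- The block matrix with given upper left block, side coordinates and Schur complement. -/
def ofCoord [Fintype R] [Ring K] (A : Matrix R R K) (v : Matrix (R × β ⊕ α × R) Unit K)
    (D : Matrix α β K) :
    Matrix (R ⊕ α) (R ⊕ β) K :=
  fromBlocks A (A * unpackL v) (unpackR v * A) (D + unpackR v * A * unpackL v)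

theorem continuous_ofCoord [Fintype R] [NontriviallyNormedField K] :
    Continuous fun p : Matrix R R K × Matrix (R × β ⊕ α × R) Unit K ×
    Matrix α β K => ofCoord p.1 p.2.1 p.2.2 := by
  have hA : Continuous fun p : Matrix R R K × Matrix (R × β ⊕ α × R) Unit K ×
    Matrix α β K => p.1 := continuous_fst
  have hb := (continuous_unpackL (K := K) (R := R) (α := α) (β := β)).comp
    ((continuous_fst.comp continuous_snd) : Continuous fun p : Matrix R R K ×
      Matrix (R × β ⊕ α × R) Unit K × Matrix α β K => p.2.1)
  have hc := (continuous_unpackR (K := K) (R := R) (α := α) (β := β)).comp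
    ((continuous_fst.comp continuous_snd) : Continuous fun p : Matrix R R K ×
      Matrix (R × β ⊕ α × R) Unit K × Matrix α β K => p.2.1)
  exact hA.matrix_fromBlocks (hA.matrix_mul hb) (hc.matrix_mul hA)
    ((continuous_snd.comp continuous_snd).add ((hc.matrix_mul hA).matrix_mul hb))

theorem continuous_toBlocks₁₁ [TopologicalSpace K] :
    Continuous (toBlocks₁₁ : Matrix (R ⊕ α) (R ⊕ β) K → Matrix R R K) :=
  continuous_matrix fun _ _ => continuous_id.matrix_elem _ _

end Pack

variable {K R α β : Type*} [Fintype R] [DecidableEq R]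

/-- The coordinates `(A⁻¹ B, C A⁻¹)` of a block matrix with blocks `A, B, C, D`. -/
noncomputable def sideCoord [Field K] (x : Matrix (R ⊕ α) (R ⊕ β) K) :
    Matrix (R × β ⊕ α × R) Unit K :=
  packLR (x.toBlocks₁₁⁻¹ * x.toBlocks₁₂) (x.toBlocks₂₁ * x.toBlocks₁₁⁻¹)

/-- The Schur complement `D - C A⁻¹ B` of a block matrix with blocks `A, B, C, D`. -/
noncomputable def schurCoord [Field K] (x : Matrix (R ⊕ α) (R ⊕ β) K) : Matrix α β K :=
  x.toBlocks₂₂ - x.toBlocks₂₁ * x.toBlocks₁₁⁻¹ * x.toBlocks₁₂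

theorem ofCoord_coord [Field K] {x : Matrix (R ⊕ α) (R ⊕ β) K} (hx : x.toBlocks₁₁.det ≠ 0) :
    ofCoord x.toBlocks₁₁ (sideCoord x) (schurCoord x) = x := by
  have hu := isUnit_iff_ne_zero.2 hx
  conv_rhs => rw [← fromBlocks_toBlocks x]
  simp only [ofCoord, sideCoord, schurCoord, unpackL_packLR, unpackR_packLR]
  rw [mul_nonsing_inv_cancel_left _ _ hu, nonsing_inv_mul_cancel_right _ _ hu,
    ← Matrix.mul_assoc, sub_add_cancel]

theorem sideCoord_ofCoord [Field K] {A : Matrix R R K} (hA : A.det ≠ 0)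
    (v : Matrix (R × β ⊕ α × R) Unit K) (D : Matrix α β K) : sideCoord (ofCoord A v D) = v := by
  have hu := isUnit_iff_ne_zero.2 hA
  simp only [sideCoord, ofCoord, toBlocks_fromBlocks₁₁, toBlocks_fromBlocks₁₂,
    toBlocks_fromBlocks₂₁]
  rw [nonsing_inv_mul_cancel_left _ _ hu, mul_nonsing_inv_cancel_right _ _ hu, packLR_unpack]

variable [NontriviallyNormedField K]

theorem continuousAt_toBlocks₁₁_inv {x : Matrix (R ⊕ α) (R ⊕ β) K} (hx : x.toBlocks₁₁.det ≠ 0) :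
    ContinuousAt (fun x : Matrix (R ⊕ α) (R ⊕ β) K => x.toBlocks₁₁⁻¹) x := by
  refine ContinuousAt.comp (g := Inv.inv) (continuousAt_matrix_inv _ ?_)
    continuous_toBlocks₁₁.continuousAt
  rw [Ring.inverse_eq_inv']
  exact continuousAt_inv₀ hx

theorem continuousAt_sideCoord {x : Matrix (R ⊕ α) (R ⊕ β) K} (hx : x.toBlocks₁₁.det ≠ 0) :
    ContinuousAt sideCoord x := by
  have hA := continuousAt_toBlocks₁₁_inv hx
  have hB : Continuous (toBlocks₁₂ : Matrix (R ⊕ α) (R ⊕ β) K → Matrix R β K) :=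
    continuous_matrix fun _ _ => continuous_id.matrix_elem _ _
  have hC : Continuous (toBlocks₂₁ : Matrix (R ⊕ α) (R ⊕ β) K → Matrix α R K) :=
    continuous_matrix fun _ _ => continuous_id.matrix_elem _ _
  have h1 : Continuous fun q : Matrix R R K × Matrix R β K × Matrix α R K =>
      (q.1 * q.2.1, q.2.2 * q.1) := by fun_prop
  exact continuous_packLR.continuousAt.comp (ContinuousAt.comp
    (f := fun x : Matrix (R ⊕ α) (R ⊕ β) K => (x.toBlocks₁₁⁻¹, x.toBlocks₁₂, x.toBlocks₂₁))
    h1.continuousAt (hA.prodMk (hB.continuousAt.prodMk hC.continuousAt)))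

theorem continuousAt_schurCoord {x : Matrix (R ⊕ α) (R ⊕ β) K} (hx : x.toBlocks₁₁.det ≠ 0) :
    ContinuousAt schurCoord x := by
  have hA := continuousAt_toBlocks₁₁_inv hx
  have hB : Continuous (toBlocks₁₂ : Matrix (R ⊕ α) (R ⊕ β) K → Matrix R β K) :=
    continuous_matrix fun _ _ => continuous_id.matrix_elem _ _
  have hC : Continuous (toBlocks₂₁ : Matrix (R ⊕ α) (R ⊕ β) K → Matrix α R K) :=
    continuous_matrix fun _ _ => continuous_id.matrix_elem _ _
  have hD : Continuous (toBlocks₂₂ : Matrix (R ⊕ α) (R ⊕ β) K → Matrix α β K) :=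
    continuous_matrix fun _ _ => continuous_id.matrix_elem _ _
  have h1 : Continuous fun q : Matrix R R K × Matrix R β K × Matrix α R K =>
      q.2.2 * q.1 * q.2.1 := by fun_prop
  exact hD.continuousAt.sub (ContinuousAt.comp
    (f := fun x : Matrix (R ⊕ α) (R ⊕ β) K => (x.toBlocks₁₁⁻¹, x.toBlocks₁₂, x.toBlocks₂₁))
    h1.continuousAt (hA.prodMk (hB.continuousAt.prodMk hC.continuousAt)))

end BlockCoordinates

section BlockPush

variable {K : Type*} [NontriviallyNormedField K] [IsUltrametricDist K] [LocallyCompactSpace K]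
  {R α β : Type*} [Fintype R] [Fintype α] [Fintype β] [DecidableEq R]

/-- The function `1_S(A) ψ(A⁻¹ B, C A⁻¹) 1_L(D - C A⁻¹ B)` of a block matrix, where `L` consists of
the matrices with integral entries. -/
noncomputable def blockPushFun (S : Set (Matrix R R K))
    (ψ : SchwartzBZ (Matrix (R × β ⊕ α × R) Unit K)) : Matrix (R ⊕ α) (R ⊕ β) K → ℂ :=
  (toBlocks₁₁ ⁻¹' S).indicator fun x =>
    (ψ : Matrix (R × β ⊕ α × R) Unit K → ℂ) (sideCoord x) *
      (indC (matLat K α β 1 one_pos) (isCompact_matLat 1 one_pos) 0 : Matrix α β K → ℂ)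
        (schurCoord x)

theorem blockPushFun_of_mem {S : Set (Matrix R R K)}
    (ψ : SchwartzBZ (Matrix (R × β ⊕ α × R) Unit K))
    {x : Matrix (R ⊕ α) (R ⊕ β) K} (hx : x.toBlocks₁₁ ∈ S) :
    blockPushFun S ψ x = (ψ : Matrix (R × β ⊕ α × R) Unit K → ℂ) (sideCoord x) *
        (indC (matLat K α β 1 one_pos) (isCompact_matLat 1 one_pos) 0 : Matrix α β K → ℂ)
          (schurCoord x) :=
  indicator_of_mem (s := (toBlocks₁₁ ⁻¹' S : Set (Matrix (R ⊕ α) (R ⊕ β) K))) hx _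

theorem blockPushFun_of_notMem {S : Set (Matrix R R K)}
    (ψ : SchwartzBZ (Matrix (R × β ⊕ α × R) Unit K))
    {x : Matrix (R ⊕ α) (R ⊕ β) K} (hx : x.toBlocks₁₁ ∉ S) : blockPushFun S ψ x = 0 :=
  indicator_of_notMem (s := (toBlocks₁₁ ⁻¹' S : Set (Matrix (R ⊕ α) (R ⊕ β) K))) hx _

/-- `blockPushFun` as a linear map between spaces of Bruhat–Schwartz functions. -/
noncomputable def blockPush (S : Set (Matrix R R K)) (hS : IsClopen S ∧ IsCompact S)
    (hS0 : ∀ A ∈ S, A.det ≠ 0) :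
    SchwartzBZ (Matrix (R × β ⊕ α × R) Unit K) →ₗ[ℂ] SchwartzBZ (Matrix (R ⊕ α) (R ⊕ β) K) where
  toFun ψ := SchwartzBZ.mk (blockPushFun S ψ)
    (fun x => by
      have hcl : IsClopen (toBlocks₁₁ ⁻¹' S : Set (Matrix (R ⊕ α) (R ⊕ β) K)) :=
        hS.1.preimage continuous_toBlocks₁₁
      by_cases hx : x.toBlocks₁₁ ∈ S
      · filter_upwards [hcl.isOpen.mem_nhds hx,
          (continuousAt_sideCoord (hS0 _ hx)).eventually (ψ.2.1.eventually_eq _),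
          (continuousAt_schurCoord (hS0 _ hx)).eventually ((indC (matLat K α β 1 one_pos)
            (isCompact_matLat 1 one_pos) 0).2.1.eventually_eq _)] with y hy h1 h2
        rw [blockPushFun_of_mem (S := S) ψ hy, blockPushFun_of_mem ψ hx, h1, h2]
      · filter_upwards [hcl.compl.isOpen.mem_nhds hx] with y hy
        rw [blockPushFun_of_notMem (S := S) ψ hy, blockPushFun_of_notMem ψ hx])
    ((fun p : Matrix R R K × Matrix (R × β ⊕ α × R) Unit K ×
      Matrix α β K => ofCoord p.1 p.2.1 p.2.2) '' (S ×ˢ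
        (Function.support (ψ : Matrix (R × β ⊕ α × R) Unit K → ℂ) ×ˢ
          (matLat K α β 1 one_pos : Set (Matrix α β K)))))
    ((hS.2.prod ((SchwartzBZ.isCompact_support ψ).prod
      (isCompact_matLat 1 one_pos))).image continuous_ofCoord)
    (fun x hx => by
      rw [Function.mem_support] at hx
      have hxS : x.toBlocks₁₁ ∈ S := by
        by_contra h
        exact hx (blockPushFun_of_notMem ψ h)
      rw [blockPushFun_of_mem ψ hxS] at hx
      refine ⟨(x.toBlocks₁₁, sideCoord x, schurCoord x), ⟨hxS, left_ne_zero_of_mul hx, ?_⟩,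
        ofCoord_coord (hS0 _ hxS)⟩
      by_contra h
      refine right_ne_zero_of_mul hx (indC_apply_of_notMem _ ?_)
      rwa [sub_zero])
  map_add' ψ ψ' := by
    ext x
    change blockPushFun S (ψ + ψ') x = blockPushFun S ψ x + blockPushFun S ψ' x
    by_cases hx : x.toBlocks₁₁ ∈ S
    · simp only [blockPushFun_of_mem _ hx]
      exact add_mul _ _ _
    · simp only [blockPushFun_of_notMem _ hx, add_zero]
  map_smul' c ψ := by
    ext x
    change blockPushFun S (c • ψ) x = c * blockPushFun S ψ x
    by_cases hx : x.toBlocks₁₁ ∈ S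
    · simp only [blockPushFun_of_mem _ hx]
      exact mul_assoc _ _ _
    · simp only [blockPushFun_of_notMem _ hx, mul_zero]

@[simp] theorem blockPush_apply {S : Set (Matrix R R K)} (hS : IsClopen S ∧ IsCompact S)
    (hS0 : ∀ A ∈ S, A.det ≠ 0) (ψ : SchwartzBZ (Matrix (R × β ⊕ α × R) Unit K))
    (x : Matrix (R ⊕ α) (R ⊕ β) K) :
    (blockPush S hS hS0 ψ : Matrix (R ⊕ α) (R ⊕ β) K → ℂ) x = blockPushFun S ψ x := rfl

end BlockPush

section BlockKill

variable {K : Type*} [NontriviallyNormedField K] {R α β : Type*} [Fintype R] [Fintype α] [Fintype β]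
  [DecidableEq R] [DecidableEq α] [DecidableEq β]

/-- A lower block unitriangular matrix. -/
def lowerU (c : Matrix α R K) : GL (R ⊕ α) K where
  val := fromBlocks 1 0 c 1
  inv := fromBlocks 1 0 (-c) 1
  val_inv := by simp [fromBlocks_multiply]
  inv_val := by simp [fromBlocks_multiply]

/-- An upper block unitriangular matrix. -/
def upperU (b : Matrix R β K) : GL (R ⊕ β) K where
  val := fromBlocks 1 b 0 1
  inv := fromBlocks 1 (-b) 0 1
  val_inv := by simp [fromBlocks_multiply]
  inv_val := by simp [fromBlocks_multiply]

theorem det_lowerU (c : Matrix α R K) : Matrix.GeneralLinearGroup.det (lowerU c) = 1 := by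
  ext
  exact (det_fromBlocks_zero₁₂ _ _ _).trans (by simp)

theorem det_upperU (b : Matrix R β K) : Matrix.GeneralLinearGroup.det (upperU b) = 1 := by
  ext
  exact (det_fromBlocks_zero₂₁ _ _ _).trans (by simp)

theorem actH_lowerU_upperU (c : Matrix α R K) (b : Matrix R β K) (A : Matrix R R K)
    (B : Matrix R β K) (C : Matrix α R K) (D : Matrix α β K) :
    actH (lowerU c) (upperU b) (fromBlocks A B C D)
      = fromBlocks A (A * b + B) (c * A + C) ((c * A + C) * b + (c * B + D)) := by
  change (fromBlocks 1 0 c 1 : Matrix (R ⊕ α) (R ⊕ α) K) * fromBlocks A B C D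
    * (fromBlocks 1 b 0 1 : Matrix (R ⊕ β) (R ⊕ β) K) = _
  simp [fromBlocks_multiply]

/-- The diagonal matrix `(t, …, t, d)`. -/
def scaleU (t : Kˣ) (d : α → Kˣ) : GL (R ⊕ α) K := diagU (Sum.elim (fun _ => t) d)

theorem actH_scaleU (t s : Kˣ) (d : α → Kˣ) (e : β → Kˣ) (A : Matrix R R K)
    (B : Matrix R β K) (C : Matrix α R K) (D : Matrix α β K) :
    actH (scaleU t d) (scaleU s e) (fromBlocks A B C D)
      = fromBlocks (Matrix.of fun i j => (t : K) * A i j * s)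
        (Matrix.of fun i j => (t : K) * B i j * e j)
        (Matrix.of fun i j => (d i : K) * C i j * s)
        (Matrix.of fun i j => (d i : K) * D i j * e j) := by
  ext i j
  rw [actH_apply, scaleU, scaleU, coe_diagU, coe_diagU, mul_diagonal, diagonal_mul]
  rcases i with i | i <;> rcases j with j | j <;> simp

theorem toBlocks₁₁_actH_scaleU (t : Kˣ) (d : α → Kˣ) (e : β → Kˣ)
    (x : Matrix (R ⊕ α) (R ⊕ β) K) :
    (actH (scaleU t d) (scaleU t⁻¹ e) x).toBlocks₁₁ = x.toBlocks₁₁ := by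
  obtain ⟨A, B, C, D, rfl⟩ : ∃ A B C D, x = fromBlocks A B C D :=
    ⟨_, _, _, _, (fromBlocks_toBlocks x).symm⟩
  rw [actH_scaleU, toBlocks_fromBlocks₁₁, toBlocks_fromBlocks₁₁]
  ext i j
  rw [of_apply, mul_right_comm, Units.mul_inv, one_mul]

theorem sideCoord_actH_scaleU (t : Kˣ) (d : α → Kˣ) (e : β → Kˣ)
    (x : Matrix (R ⊕ α) (R ⊕ β) K) :
    sideCoord (actH (scaleU t d) (scaleU t⁻¹ e) x)
      = actH (diagU (Sum.elim (fun q => t * e q.2) fun q => d q.1 * t⁻¹)) (1 : GL Unit K)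
        (sideCoord x) := by
  obtain ⟨A, B, C, D, rfl⟩ : ∃ A B C D, x = fromBlocks A B C D :=
    ⟨_, _, _, _, (fromBlocks_toBlocks x).symm⟩
  have hA : (Matrix.of fun i j => (t : K) * A i j * ((t⁻¹ : Kˣ) : K)) = A := by
    ext i j
    rw [of_apply, mul_right_comm, Units.mul_inv, one_mul]
  rw [actH_scaleU, hA]
  ext p u
  rw [actH_apply, coe_diagU, Units.val_one, Matrix.mul_one, diagonal_mul]
  rcases p with p | p <;> simp only [sideCoord, packLR, toBlocks_fromBlocks₁₁,
    toBlocks_fromBlocks₁₂, toBlocks_fromBlocks₂₁, of_apply, Sum.elim_inl, Sum.elim_inr,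
    Matrix.mul_apply, Finset.mul_sum, Units.val_mul] <;>
    exact Finset.sum_congr rfl fun _ _ => by ring

theorem schurCoord_actH_scaleU_eq_zero (t : Kˣ) (d : α → Kˣ) (e : β → Kˣ)
    {x : Matrix (R ⊕ α) (R ⊕ β) K} (hx : schurCoord x = 0) :
    schurCoord (actH (scaleU t d) (scaleU t⁻¹ e) x) = 0 := by
  obtain ⟨A, B, C, D, rfl⟩ : ∃ A B C D, x = fromBlocks A B C D :=
    ⟨_, _, _, _, (fromBlocks_toBlocks x).symm⟩
  have hA : (Matrix.of fun i j => (t : K) * A i j * ((t⁻¹ : Kˣ) : K)) = A := by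
    ext i j
    rw [of_apply, mul_right_comm, Units.mul_inv, one_mul]
  rw [actH_scaleU, hA]
  ext i j
  have := congrArg (fun z => (d i : K) * z * e j) (congrFun (congrFun hx i) j)
  simp only [schurCoord, toBlocks_fromBlocks₁₁, toBlocks_fromBlocks₁₂, toBlocks_fromBlocks₂₁,
    toBlocks_fromBlocks₂₂, Matrix.sub_apply, Matrix.zero_apply, mul_zero, zero_mul] at this ⊢
  rw [← this, mul_sub, sub_mul]
  congr 1
  simp only [Matrix.mul_apply, Finset.mul_sum, Finset.sum_mul, of_apply]
  refine Finset.sum_congr rfl fun k _ => Finset.sum_congr rfl fun l _ => ?_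
  rw [show (d i : K) * C i l * ((t⁻¹ : Kˣ) : K) * A⁻¹ l k * ((t : K) * B k j * e j)
    = (((t⁻¹ : Kˣ) : K) * t) * ((d i : K) * (C i l * A⁻¹ l k * B k j) * e j) by ring,
    Units.inv_mul, one_mul]

variable [IsUltrametricDist K] [LocallyCompactSpace K]

theorem SLInv.transInv_comp_blockPush {η : SchwartzBZ (Matrix (R ⊕ α) (R ⊕ β) K) →ₗ[ℂ] ℂ}
    (hη : SLInv η) (S : Set (Matrix R R K)) (hS : IsClopen S ∧ IsCompact S)
    (hS0 : ∀ A ∈ S, A.det ≠ 0) : TransInv (η ∘ₗ blockPush S hS hS0) := by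
  intro v ψ
  rw [LinearMap.comp_apply, LinearMap.comp_apply,
    ← hη (lowerU (unpackR v)) (upperU (unpackL v)) (det_lowerU _) (det_upperU _)
      (blockPush S hS hS0 ψ)]
  congr 1
  ext x
  obtain ⟨A, B, C, D, rfl⟩ : ∃ A B C D, x = fromBlocks A B C D :=
    ⟨_, _, _, _, (fromBlocks_toBlocks x).symm⟩
  rw [pullH_apply, actH_lowerU_upperU, blockPush_apply, blockPush_apply]
  by_cases hA : A ∈ S
  · have hu := isUnit_iff_ne_zero.2 (hS0 A hA)
    rw [blockPushFun_of_mem _ (by simpa using hA), blockPushFun_of_mem _ (by simpa using hA),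
      pullH_apply, Homeomorph.coe_addRight]
    congr 2
    · simp only [sideCoord, toBlocks_fromBlocks₁₁, toBlocks_fromBlocks₁₂, toBlocks_fromBlocks₂₁]
      rw [Matrix.mul_add, nonsing_inv_mul_cancel_left _ _ hu, Matrix.add_mul,
        mul_nonsing_inv_cancel_right _ _ hu, packLR_add, packLR_unpack, add_comm]
    · simp only [schurCoord, toBlocks_fromBlocks₁₁, toBlocks_fromBlocks₁₂, toBlocks_fromBlocks₂₁,
        toBlocks_fromBlocks₂₂]
      simp only [Matrix.mul_add, Matrix.add_mul, mul_nonsing_inv_cancel_left _ _ hu,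
        Matrix.mul_assoc, nonsing_inv_mul_cancel_left _ _ hu]
      refine congrArg _ ?_
      abel
  · rw [blockPushFun_of_notMem _ (by simpa using hA), blockPushFun_of_notMem _ (by simpa using hA)]

theorem SLInv.comp_blockPush_eq_zero [CharZero K] [Nonempty R] [Nonempty α] [Nonempty β]
    [MeasurableSpace K] [BorelSpace K] (μK : Measure K) [μK.IsAddHaarMeasure]
    (hnormed : ∀ a : K, a ≠ 0 → ∀ s : Set K, MeasurableSet s →
      μK ((a * ·) '' s) = ENNReal.ofReal ‖a‖ * μK s)
    (hcard : Fintype.card α ≠ Fintype.card β)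
    {η : SchwartzBZ (Matrix (R ⊕ α) (R ⊕ β) K) →ₗ[ℂ] ℂ} (hη : SLInv η)
    (hk : Kills η {x | x.toBlocks₁₁.det ≠ 0 ∧ schurCoord x ≠ 0})
    (S : Set (Matrix R R K)) (hS : IsClopen S ∧ IsCompact S) (hS0 : ∀ A ∈ S, A.det ≠ 0) :
    η ∘ₗ blockPush S hS hS0 = 0 := by
  obtain ⟨a₀⟩ := ‹Nonempty α›
  obtain ⟨b₀⟩ := ‹Nonempty β›
  obtain ⟨t₀, ht₀⟩ := NormedField.exists_one_lt_norm K
  obtain ⟨t, rfl⟩ : ∃ t : Kˣ, (t : K) = t₀ :=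
    ⟨Units.mk0 t₀ (norm_pos_iff.1 (one_pos.trans ht₀)), rfl⟩
  set r := Fintype.card R with hr
  have hr0 : 0 < r := Fintype.card_pos
  let d : α → Kˣ := Pi.mulSingle a₀ (t ^ (-(r : ℤ)))
  let e : β → Kˣ := Pi.mulSingle b₀ (t ^ (r : ℤ))
  have hd : ∏ a, d a = t ^ (-(r : ℤ)) := by simp [d, Finset.prod_pi_mulSingle']
  have he : ∏ b, e b = t ^ (r : ℤ) := by simp [e, Finset.prod_pi_mulSingle']
  have hg : Matrix.GeneralLinearGroup.det (scaleU (R := R) t d) = 1 := by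
    rw [scaleU, det_diagU, Fintype.prod_sum_type]
    simp [hd, ← hr]
  have hh : Matrix.GeneralLinearGroup.det (scaleU (R := R) t⁻¹ e) = 1 := by
    rw [scaleU, det_diagU, Fintype.prod_sum_type]
    simp [he, ← hr]
  set v : R × β ⊕ α × R → Kˣ := Sum.elim (fun q => t * e q.2) fun q => d q.1 * t⁻¹ with hv
  have hdet : ∏ p, v p = t ^ ((r : ℤ) * (Fintype.card β - Fintype.card α)) := by
    rw [Fintype.prod_sum_type, Fintype.prod_prod_type, Fintype.prod_prod_type_right]
    simp only [hv, Sum.elim_inl, Sum.elim_inr, Finset.prod_mul_distrib, hd, he, Finset.prod_const,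
      Finset.card_univ, ← hr]
    simp only [← zpow_natCast, ← _root_.zpow_mul, ← _root_.zpow_add, _root_.inv_zpow']
    congr 1
    ring
  ext ψ
  have hζ := hη.transInv_comp_blockPush S hS hS0
  have hmod := hζ.apply_left μK hnormed (diagU v) ψ
  have hinv : (η ∘ₗ blockPush S hS hS0) (pullH (actH (diagU v) 1) ψ)
      = (η ∘ₗ blockPush S hS hS0) ψ := by
    rw [LinearMap.comp_apply, LinearMap.comp_apply, ← hη _ _ hg hh (blockPush S hS hS0 ψ),
      ← sub_eq_zero, ← map_sub]
    refine hk _ fun x hx => ?_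
    have hx' : blockPushFun S (pullH (actH (diagU v) 1) ψ) x
        - blockPushFun S ψ (actH (scaleU t d) (scaleU t⁻¹ e) x) ≠ 0 := hx
    have hxS : x.toBlocks₁₁ ∈ S := by
      by_contra h
      refine hx' ?_
      rw [blockPushFun_of_notMem _ h,
        blockPushFun_of_notMem _ (by rwa [toBlocks₁₁_actH_scaleU]), sub_zero]
    refine ⟨hS0 _ hxS, fun h0 => hx' ?_⟩
    rw [blockPushFun_of_mem _ hxS, blockPushFun_of_mem _ (by rwa [toBlocks₁₁_actH_scaleU]), h0,
      schurCoord_actH_scaleU_eq_zero t d e h0, sideCoord_actH_scaleU, pullH_apply, sub_self]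
  rw [hinv, ← GeneralLinearGroup.val_det_apply, det_diagU, hdet] at hmod
  by_contra hne
  have h1 : (‖(t : K)‖ ^ ((r : ℤ) * (Fintype.card β - Fintype.card α))) = 1 := by
    rw [Fintype.card_unit, Nat.cast_one, Units.val_zpow_eq_zpow_val, norm_zpow] at hmod
    have h2 := mul_right_cancel₀ hne ((one_mul _).trans hmod)
    rw [_root_.zpow_neg_one] at h2
    exact inv_eq_one.1 (by exact_mod_cast h2.symm)
  rw [zpow_eq_one_iff_right₀ (norm_nonneg _) ht₀.ne', mul_eq_zero, sub_eq_zero] at h1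
  rcases h1 with h1 | h1
  · exact hr0.ne' (by exact_mod_cast h1)
  · exact hcard (by exact_mod_cast h1.symm)

end BlockKill

section MidRank

variable {K : Type*} [NontriviallyNormedField K] {R α β : Type*} [Fintype R] [Fintype α] [Fintype β]
  [DecidableEq R] [DecidableEq α] [DecidableEq β] [IsUltrametricDist K] [LocallyCompactSpace K]

theorem SLInv.kills_det_toBlocks₁₁_ne_zero [CharZero K] [Nonempty R] [Nonempty α] [Nonempty β]
    [MeasurableSpace K] [BorelSpace K] (μK : Measure K) [μK.IsAddHaarMeasure]
    (hnormed : ∀ a : K, a ≠ 0 → ∀ s : Set K, MeasurableSet s →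
      μK ((a * ·) '' s) = ENNReal.ofReal ‖a‖ * μK s)
    (hcard : Fintype.card α ≠ Fintype.card β)
    {η : SchwartzBZ (Matrix (R ⊕ α) (R ⊕ β) K) →ₗ[ℂ] ℂ} (hη : SLInv η)
    (hk : Kills η {x | x.toBlocks₁₁.det ≠ 0 ∧ schurCoord x ≠ 0}) :
    Kills η {x | x.toBlocks₁₁.det ≠ 0} := by
  intro φ hφ
  refine apply_eq_zero_of_local η φ continuous_toBlocks₁₁ fun x₀ hx₀ => ?_
  set A₀ := x₀.toBlocks₁₁
  have hA₀ : A₀.det ≠ 0 := hφ hx₀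
  let Q : Set (Matrix (R × β ⊕ α × R) Unit K) :=
    sideCoord '' Function.support (φ : Matrix (R ⊕ α) (R ⊕ β) K → ℂ)
  have hQ : IsCompact Q := (SchwartzBZ.isCompact_support φ).image_of_continuousOn fun x hx =>
    (continuousAt_sideCoord (hφ hx)).continuousWithinAt
  have hφQ : ∀ A : Matrix R R K, A.det ≠ 0 → ∀ v ∉ Q,
      (φ : Matrix (R ⊕ α) (R ⊕ β) K → ℂ) (ofCoord A v 0) = 0 := fun A hA v hv => by
    by_contra h
    exact hv ⟨ofCoord A v 0, h, sideCoord_ofCoord hA v 0⟩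
  have hc : Continuous fun p : Matrix R R K × Matrix (R × β ⊕ α × R) Unit K =>
      (ofCoord p.1 p.2 0 : Matrix (R ⊕ α) (R ⊕ β) K) :=
    continuous_ofCoord.comp (continuous_fst.prodMk (continuous_snd.prodMk continuous_const))
  have hc₀ : Continuous fun v : Matrix (R × β ⊕ α × R) Unit K =>
      (ofCoord A₀ v 0 : Matrix (R ⊕ α) (R ⊕ β) K) :=
    hc.comp (continuous_const.prodMk continuous_id)
  let f : SchwartzBZ (Matrix (R × β ⊕ α × R) Unit K) := SchwartzBZ.mk
    (fun v => (φ : Matrix (R ⊕ α) (R ⊕ β) K → ℂ) (ofCoord A₀ v 0))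
    (fun v => hc₀.continuousAt.eventually (φ.2.1.eventually_eq _)) Q hQ
    (fun v hv => by
      by_contra h
      exact hv (hφQ A₀ hA₀ v h))
  have hnear : ∀ᶠ A in 𝓝 A₀, ∀ v ∈ Q, (φ : Matrix (R ⊕ α) (R ⊕ β) K → ℂ) (ofCoord A v 0)
      = (φ : Matrix (R ⊕ α) (R ⊕ β) K → ℂ) (ofCoord A₀ v 0) := by
    refine hQ.eventually_forall_of_forall_eventually fun v _ => ?_
    filter_upwards [hc.continuousAt.eventually (φ.2.1.eventually_eq (ofCoord A₀ v 0)),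
      (hc₀.comp continuous_snd).continuousAt.eventually
        (φ.2.1.eventually_eq (ofCoord A₀ v 0))] with z h1 h2
    exact h1.trans h2.symm
  have hdet : ∀ᶠ A in 𝓝 A₀, A.det ≠ 0 :=
    (continuous_id.matrix_det.continuousAt (x := A₀)).eventually_ne hA₀
  obtain ⟨L, hLU, hL⟩ := exists_openAddSubgroup_isCompact
    (((continuous_add_const A₀).tendsto' 0 A₀ (zero_add _)).eventually (hnear.and hdet))
  have hC : ∀ A ∈ cosetSet L A₀, (∀ v ∈ Q, (φ : Matrix (R ⊕ α) (R ⊕ β) K → ℂ) (ofCoord A v 0)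
      = (φ : Matrix (R ⊕ α) (R ⊕ β) K → ℂ) (ofCoord A₀ v 0)) ∧ A.det ≠ 0 := fun A hA => by
    have := hLU hA
    rwa [mem_ofPred_eq, sub_add_cancel] at this
  have hCp := cosetSet_prop (L := L) hL A₀
  refine ⟨cosetSet L A₀, hCp.1, by simp [mem_cosetSet, A₀], fun C' hC' hsub => ?_⟩
  have hC'0 : ∀ A ∈ C', A.det ≠ 0 := fun A hA => (hC A (hsub hA)).2
  have hC'c : IsClopen C' ∧ IsCompact C' := ⟨hC', hCp.2.of_isClosed_subset hC'.1 hsub⟩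
  have h0 := LinearMap.congr_fun (hη.comp_blockPush_eq_zero μK hnormed hcard hk C' hC'c hC'0) f
  rw [LinearMap.comp_apply, LinearMap.zero_apply] at h0
  refine (sub_eq_zero.1 ?_ : η _ = η (blockPush C' hC'c hC'0 f)).trans h0
  rw [← map_sub]
  refine hk _ fun x hx => ?_
  have hx' : (toBlocks₁₁ ⁻¹' C').indicator (φ : Matrix (R ⊕ α) (R ⊕ β) K → ℂ) x
      - blockPushFun C' f x ≠ 0 := hx
  have hxC : x.toBlocks₁₁ ∈ C' := by
    by_contra h
    refine hx' ?_
    rw [blockPushFun_of_notMem _ h, indicator_of_notMem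
      (s := (toBlocks₁₁ ⁻¹' C' : Set (Matrix (R ⊕ α) (R ⊕ β) K))) h, sub_zero]
  have hxd := hC'0 _ hxC
  refine ⟨hxd, fun hs => hx' ?_⟩
  have hxe := ofCoord_coord hxd
  rw [blockPushFun_of_mem _ hxC, indicator_of_mem
    (s := (toBlocks₁₁ ⁻¹' C' : Set (Matrix (R ⊕ α) (R ⊕ β) K))) hxC, hs,
    indC_apply_of_mem _ (by rw [sub_zero]; exact zero_mem _), mul_one, sub_eq_zero]
  change _ = (φ : Matrix (R ⊕ α) (R ⊕ β) K → ℂ) (ofCoord A₀ (sideCoord x) 0)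
  rw [hs] at hxe
  by_cases hv : sideCoord x ∈ Q
  · rw [← (hC _ (hsub hxC)).1 _ hv, hxe]
  · rw [hφQ A₀ hA₀ _ hv, ← hxe, hφQ _ hxd _ hv]

end MidRank

section Reindex

variable {K : Type*} [NontriviallyNormedField K]

theorem Kills.preimage_of_comp_pullH {X Y : Type*} [TopologicalSpace X] [TopologicalSpace Y]
    {η : SchwartzBZ X →ₗ[ℂ] ℂ} {e : X ≃ₜ Y} {W : Set Y} (h : Kills (η ∘ₗ pullH e) W) :
    Kills η (e ⁻¹' W) := by
  intro φ hφ
  have he : pullH e (pullH e.symm φ) = φ := by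
    ext x
    simp only [pullH_apply, Homeomorph.symm_apply_apply]
  rw [← he]
  refine h _ fun x hx => ?_
  have := hφ (show e.symm x ∈ Function.support (φ : X → ℂ) from hx)
  simpa only [mem_preimage, Homeomorph.apply_symm_apply] using this

/-- Reindexing rows and columns, as a homeomorphism. -/
def reindexH {ι κ ι' κ' : Type*} (e₁ : ι' ≃ ι) (e₂ : κ' ≃ κ) :
    Matrix ι κ K ≃ₜ Matrix ι' κ' K where
  toFun x := x.submatrix e₁ e₂
  invFun x := x.submatrix e₁.symm e₂.symm
  left_inv x := by ext; simp
  right_inv x := by ext; simp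
  continuous_toFun := continuous_id.matrix_submatrix _ _
  continuous_invFun := continuous_id.matrix_submatrix _ _

@[simp] theorem reindexH_apply {ι κ ι' κ' : Type*} (e₁ : ι' ≃ ι) (e₂ : κ' ≃ κ)
    (x : Matrix ι κ K) : reindexH e₁ e₂ x = x.submatrix e₁ e₂ := rfl

variable {ι κ ι' κ' : Type*} [Fintype ι] [Fintype κ] [Fintype ι'] [Fintype κ']
  [DecidableEq ι] [DecidableEq κ] [DecidableEq ι'] [DecidableEq κ']

theorem SLInv.comp_pullH_reindexH {η : SchwartzBZ (Matrix ι κ K) →ₗ[ℂ] ℂ} (hη : SLInv η)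
    (e₁ : ι' ≃ ι) (e₂ : κ' ≃ κ) : SLInv (η ∘ₗ pullH (reindexH (K := K) e₁ e₂)) := by
  intro g h hg hh φ
  let g' : GL ι K := Units.map (reindexRingEquiv K e₁ : Matrix ι' ι' K →* Matrix ι ι K) g
  let h' : GL κ K := Units.map (reindexRingEquiv K e₂ : Matrix κ' κ' K →* Matrix κ κ K) h
  have hg' : Matrix.GeneralLinearGroup.det g' = 1 := by
    ext
    exact (det_submatrix_equiv_self e₁.symm _).trans (congrArg Units.val hg)
  have hh' : Matrix.GeneralLinearGroup.det h' = 1 := by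
    ext
    exact (det_submatrix_equiv_self e₂.symm _).trans (congrArg Units.val hh)
  rw [LinearMap.comp_apply, LinearMap.comp_apply, ← hη g' h' hg' hh' (pullH _ φ)]
  refine congrArg η ?_
  ext x
  simp only [pullH_apply, actH_apply, reindexH_apply]
  refine congrArg _ ?_
  rw [← submatrix_mul_equiv _ _ _ e₂, ← submatrix_mul_equiv _ _ _ e₁]
  congr 2
  · ext i j
    exact (congrArg₂ _ (e₁.symm_apply_apply i) (e₁.symm_apply_apply j)).symm
  · ext i j
    exact (congrArg₂ _ (e₂.symm_apply_apply i) (e₂.symm_apply_apply j)).symm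

end Reindex

section Descent

/-- The matrices with a nonvanishing minor of order `r`. -/
def minorSet (K ι κ : Type*) [Field K] (r : ℕ) : Set (Matrix ι κ K) :=
  {x | ∃ (τ : Fin r → ι) (σ : Fin r → κ), (x.submatrix τ σ).det ≠ 0}

theorem mem_minorSet_succ_of_schurCoord_ne_zero {K α β : Type*} [Field K] {r : ℕ}
    {x : Matrix (Fin r ⊕ α) (Fin r ⊕ β) K} (hx : x.toBlocks₁₁.det ≠ 0) (hs : schurCoord x ≠ 0) :
    ∃ (τ : Fin (r + 1) → Fin r ⊕ α) (σ : Fin (r + 1) → Fin r ⊕ β),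
      (x.submatrix τ σ).det ≠ 0 := by
  obtain ⟨a, b, hab⟩ : ∃ a b, schurCoord x a b ≠ 0 := by
    by_contra! h
    exact hs (Matrix.ext h)
  refine ⟨Sum.map id (fun _ => a) ∘ finSumFinEquiv.symm,
    Sum.map id (fun _ => b) ∘ finSumFinEquiv.symm, ?_⟩
  rw [← submatrix_submatrix, det_submatrix_equiv_self, ← fromBlocks_toBlocks
    (x.submatrix (Sum.map id fun _ : Fin 1 => a) (Sum.map id fun _ : Fin 1 => b))]
  let := invertibleOfIsUnitDet x.toBlocks₁₁ (isUnit_iff_ne_zero.2 hx)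
  let : Invertible (x.submatrix (Sum.map id fun _ : Fin 1 => a)
    (Sum.map id fun _ : Fin 1 => b)).toBlocks₁₁ := this
  rw [det_fromBlocks₁₁, det_unique (n := Fin 1)]
  refine mul_ne_zero hx ?_
  rw [invOf_eq_nonsing_inv]
  exact hab

variable {K : Type*} [NontriviallyNormedField K] [IsUltrametricDist K] [LocallyCompactSpace K]
  [TotallyDisconnectedSpace K] [CharZero K] [MeasurableSpace K] [BorelSpace K]

theorem SLInv.kills_minorSet_of_succ (μK : Measure K) [μK.IsAddHaarMeasure]
    (hnormed : ∀ a : K, a ≠ 0 → ∀ s : Set K, MeasurableSet s →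
      μK ((a * ·) '' s) = ENNReal.ofReal ‖a‖ * μK s) {m n r : ℕ} (hmn : m ≠ n) (hr : 0 < r)
    (hrm : r < m) (hrn : r < n) {η : SchwartzBZ (Matrix (Fin m) (Fin n) K) →ₗ[ℂ] ℂ}
    (hη : SLInv η) (h : Kills η (minorSet K (Fin m) (Fin n) (r + 1))) :
    Kills η (minorSet K (Fin m) (Fin n) r) := by
  have key : ∀ p : (Fin r → Fin m) × (Fin r → Fin n),
      Kills η {x | (x.submatrix p.1 p.2).det ≠ 0} := by
    rintro ⟨τ, σ⟩
    by_cases hinj : Function.Injective τ ∧ Function.Injective σ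
    · obtain ⟨e₁, he₁⟩ := exists_equiv_sum (β := Fin (m - r)) (by simp; omega) hinj.1
      obtain ⟨e₂, he₂⟩ := exists_equiv_sum (β := Fin (n - r)) (by simp; omega) hinj.2
      have : NeZero r := ⟨hr.ne'⟩
      have : NeZero (m - r) := ⟨by omega⟩
      have : NeZero (n - r) := ⟨by omega⟩
      have hb := (hη.comp_pullH_reindexH e₁ e₂).kills_det_toBlocks₁₁_ne_zero μK hnormed
        (by simp; omega) ?_
      · refine hb.preimage_of_comp_pullH.mono fun x hx => ?_
        have hx' : (x.submatrix τ σ).det ≠ 0 := hx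
        have he : (reindexH e₁ e₂ x).toBlocks₁₁ = x.submatrix τ σ := by
          ext i j
          simp [toBlocks₁₁, he₁, he₂]
        rwa [mem_preimage, mem_ofPred_eq, he]
      · intro φ hφ
        refine h _ fun x hx => ?_
        obtain ⟨h1, h2⟩ := hφ (show reindexH e₁ e₂ x ∈ Function.support _ from hx)
        obtain ⟨τ', σ', h3⟩ := mem_minorSet_succ_of_schurCoord_ne_zero h1 h2
        exact ⟨_, _, h3⟩
    · intro φ hφ
      obtain rfl : φ = 0 := by
        ext x
        by_contra hx
        exact hinj (injective_of_det_submatrix_ne_zero (hφ hx))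
      exact map_zero η
  refine (kills_iUnion (fun p => ?_) key).mono ?_
  · exact isOpen_ne_fun (continuous_id.matrix_submatrix _ _).matrix_det continuous_const
  · rintro x ⟨τ, σ, hx⟩
    exact mem_iUnion.2 ⟨(τ, σ), hx⟩

/-- A special linear invariant distribution on nonsquare matrices that vanishes on the matrices of
full rank is supported at the origin. -/
theorem SLInv.kills_ne_zero (μK : Measure K) [μK.IsAddHaarMeasure]
    (hnormed : ∀ a : K, a ≠ 0 → ∀ s : Set K, MeasurableSet s →
      μK ((a * ·) '' s) = ENNReal.ofReal ‖a‖ * μK s) {m n : ℕ} (hm : 0 < m) (hmn : m < n)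
    {η : SchwartzBZ (Matrix (Fin m) (Fin n) K) →ₗ[ℂ] ℂ} (hη : SLInv η)
    (h : Kills η {x | ∃ σ : Fin m → Fin n, (x.submatrix id σ).det ≠ 0}) :
    Kills η {0}ᶜ := by
  have hfull : Kills η (minorSet K (Fin m) (Fin n) m) := h.mono <| by
    rintro x ⟨τ, σ, hx⟩
    let e := Equiv.ofBijective τ
      (Finite.injective_iff_bijective.1 (injective_of_det_submatrix_ne_zero hx).1)
    refine ⟨σ ∘ e.symm, ?_⟩
    rw [← det_submatrix_equiv_self e, submatrix_submatrix]
    convert hx using 2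
    ext i j
    simp [e]
  have hone : Kills η (minorSet K (Fin m) (Fin n) 1) :=
    Nat.decreasingInduction' (P := fun r => Kills η (minorSet K (Fin m) (Fin n) r))
      (fun r hrm hr hs => hη.kills_minorSet_of_succ μK hnormed hmn.ne hr hrm (hrm.trans hmn) hs)
      hm hfull
  refine hone.mono fun x hx => ?_
  obtain ⟨a, b, hab⟩ : ∃ a b, x a b ≠ 0 := by
    by_contra! h0
    exact hx (Matrix.ext h0)
  exact ⟨fun _ => a, fun _ => b, by simpa using hab⟩

end Descent

section Classification

variable {K : Type*} [NontriviallyNormedField K] [IsUltrametricDist K] [LocallyCompactSpace K]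
  {m n : ℕ}

theorem Kills.exists_eq_smul_deltaZero {η : SchwartzBZ (Matrix (Fin m) (Fin n) K) →ₗ[ℂ] ℂ}
    (h : Kills η {0}ᶜ) : ∃ c : ℂ, η = c • deltaZero K m n := by
  let ψ := indC (matLat K (Fin m) (Fin n) 1 one_pos) (isCompact_matLat 1 one_pos) 0
  have hψ : (ψ : Matrix (Fin m) (Fin n) K → ℂ) 0 = 1 :=
    indC_apply_of_mem (L := matLat K (Fin m) (Fin n) 1 one_pos) _
      (by rw [sub_zero]; exact zero_mem _)
  refine ⟨η ψ, ?_⟩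
  ext φ
  have h0 : η (φ - (φ : Matrix (Fin m) (Fin n) K → ℂ) 0 • ψ) = 0 := by
    refine h _ ?_
    rintro x hx rfl
    refine hx ?_
    change (φ : Matrix (Fin m) (Fin n) K → ℂ) 0 - (φ : Matrix (Fin m) (Fin n) K → ℂ) 0
      * (ψ : Matrix (Fin m) (Fin n) K → ℂ) 0 = 0
    rw [hψ, mul_one, sub_self]
  rw [map_sub, map_smul, sub_eq_zero] at h0
  exact h0.trans (mul_comm _ _)

variable [CharZero K] [MeasurableSpace K] [BorelSpace K]

theorem TransInv.slInv (μK : Measure K) [μK.IsAddHaarMeasure]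
    (hnormed : ∀ a : K, a ≠ 0 → ∀ s : Set K, MeasurableSet s →
      μK ((a * ·) '' s) = ENNReal.ofReal ‖a‖ * μK s)
    {ι κ : Type*} [Fintype ι] [Fintype κ] [DecidableEq ι] [DecidableEq κ] [Nonempty ι] [Nonempty κ]
    {Λ : SchwartzBZ (Matrix ι κ K) →ₗ[ℂ] ℂ} (hΛ : TransInv Λ) : SLInv Λ := by
  intro g h hg hh φ
  rw [hΛ.apply_actH μK hnormed, ← GeneralLinearGroup.val_det_apply,
    ← GeneralLinearGroup.val_det_apply, hg, hh]
  simp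

variable [TotallyDisconnectedSpace K]

theorem SLInv.exists_eq_of_lt (μK : Measure K) [μK.IsAddHaarMeasure]
    (hnormed : ∀ a : K, a ≠ 0 → ∀ s : Set K, MeasurableSet s →
      μK ((a * ·) '' s) = ENNReal.ofReal ‖a‖ * μK s) (hm : 0 < m) (hmn : m < n)
    {η Λ : SchwartzBZ (Matrix (Fin m) (Fin n) K) →ₗ[ℂ] ℂ} (hη : SLInv η) (hΛt : TransInv Λ)
    (hΛ0 : ∀ L hL y, Λ (indC L hL y) ≠ 0) : ∃ c c' : ℂ, η = c • Λ + c' • deltaZero K m n := by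
  have : NeZero m := ⟨hm.ne'⟩
  have : NeZero n := ⟨by omega⟩
  have hΛ := hΛt.slInv μK hnormed
  obtain ⟨c, hc⟩ := hη.exists_kills_full_rank hmn hΛ hΛt hΛ0
  obtain ⟨c', hc'⟩ :=
    ((hη.sub (hΛ.smul c)).kills_ne_zero μK hnormed hm hmn hc).exists_eq_smul_deltaZero
  exact ⟨c, c', by rw [← hc', add_sub_cancel]⟩

/-- On nonsquare matrices, the special linear invariant distributions are spanned by a Haar measure
and the delta distribution at the origin. -/
theorem SLInv.exists_eq (μK : Measure K) [μK.IsAddHaarMeasure]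
    (hnormed : ∀ a : K, a ≠ 0 → ∀ s : Set K, MeasurableSet s →
      μK ((a * ·) '' s) = ENNReal.ofReal ‖a‖ * μK s) (hm : 0 < m) (hn : 0 < n) (hmn : m ≠ n)
    {η Λ : SchwartzBZ (Matrix (Fin m) (Fin n) K) →ₗ[ℂ] ℂ} (hη : SLInv η) (hΛt : TransInv Λ)
    (hΛ0 : ∀ L hL y, Λ (indC L hL y) ≠ 0) : ∃ c c' : ℂ, η = c • Λ + c' • deltaZero K m n := by
  rcases hmn.lt_or_gt with hmn | hmn
  · exact hη.exists_eq_of_lt μK hnormed hm hmn hΛt hΛ0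
  obtain ⟨Λ', hΛ't, hΛ'0, -⟩ := exists_transInv_diagU (ι := Fin n) (κ := Fin m) μK hnormed
  have hηT : SLInv (η ∘ₗ pullH transposeH) := by
    intro g h hg hh φ
    rw [LinearMap.comp_apply, LinearMap.comp_apply,
      ← hη (transposeU h) (transposeU g) (by rwa [det_transposeU]) (by rwa [det_transposeU])
        (pullH transposeH φ)]
    refine congrArg η ?_
    ext x
    have := congrArg transposeH (transposeH_actH g h (transposeH x))
    exact congrArg (φ : Matrix (Fin n) (Fin m) K → ℂ) this
  obtain ⟨c, c', h⟩ := hηT.exists_eq_of_lt μK hnormed hn hmn hΛ't hΛ'0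
  have hΛ'T : TransInv (Λ' ∘ₗ pullH transposeH) := hΛ't.comp_pullH _ fun x y => rfl
  have hd := hΛt.exists_eq_smul hΛ'T (hΛ0 (matLat K _ _ 1 one_pos) (isCompact_matLat 1 one_pos) 0)
  set d : ℂ := _ / _
  refine ⟨c * d, c', ?_⟩
  ext φ
  have h1 := LinearMap.congr_fun h (pullH transposeH φ)
  have h2 := LinearMap.congr_fun hd φ
  have h3 : Λ' (pullH transposeH φ) = d * Λ φ := h2
  have h4 : η φ = c * Λ' (pullH transposeH φ) + c' * deltaZero K m n φ := h1
  rw [h4, h3, ← mul_assoc]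
  rfl

end Classification

section Characters

variable {K : Type*} [NontriviallyNormedField K] {m n : ℕ}

/-- The representation of `GL_m(K) × GL_n(K)` on distributions given by `actDist`. -/
noncomputable def distRep (χ₁ χ₂ : Kˣ →* ℂˣ) : GL (Fin m) K × GL (Fin n) K →*
    Module.End ℂ (SchwartzBZ (Matrix (Fin m) (Fin n) K) →ₗ[ℂ] ℂ) where
  toFun g :=
    { toFun := actDist χ₁ χ₂ g
      map_add' := fun η η' => by rw [actDist, LinearMap.add_comp, smul_add]; rfl
      map_smul' := fun c η => by rw [actDist, LinearMap.smul_comp, smul_comm]; rfl }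
  map_one' := by
    ext η φ
    have : pullbackS (matActHomeo (1 : GL (Fin m) K) (1 : GL (Fin n) K)) φ = φ := by
      ext x
      simp [matActHomeo]
    simp [actDist, this]
  map_mul' g h := by
    ext η φ
    have : pullbackS (matActHomeo (g * h).1 (g * h).2) φ
        = pullbackS (matActHomeo h.1 h.2) (pullbackS (matActHomeo g.1 g.2) φ) := by
      ext x
      simp only [pullbackS_apply]
      refine congrArg _ ?_
      change ((g.1 * h.1 : GL (Fin m) K) : Matrix (Fin m) (Fin m) K) * x
        * ((g.2 * h.2)⁻¹ : GL (Fin n) K).val = g.1.val * (h.1.val * x * (h.2⁻¹ : GL (Fin n) K).val)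
          * (g.2⁻¹ : GL (Fin n) K).val
      rw [_root_.mul_inv_rev, Units.val_mul, Units.val_mul]
      simp only [Matrix.mul_assoc]
    change _ * η _ = _ * (_ * η _)
    rw [this, Prod.fst_mul, Prod.snd_mul, map_mul, map_mul, map_mul, map_mul, Units.val_mul,
      Units.val_mul]
    ring

@[simp] theorem distRep_apply (χ₁ χ₂ : Kˣ →* ℂˣ) (g : GL (Fin m) K × GL (Fin n) K)
    (η : SchwartzBZ (Matrix (Fin m) (Fin n) K) →ₗ[ℂ] ℂ) :
    distRep χ₁ χ₂ g η = actDist χ₁ χ₂ g η := rfl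

theorem mem_genFix_distRep {χ₁ χ₂ : Kˣ →* ℂˣ} {k : ℕ} :
    ∀ {η : SchwartzBZ (Matrix (Fin m) (Fin n) K) →ₗ[ℂ] ℂ},
      (∀ l : List (GL (Fin m) K × GL (Fin n) K), l.length = k →
        l.foldr (fun g η' => actDist χ₁ χ₂ g η' - η') η = 0) → η ∈ genFix (distRep χ₁ χ₂) k := by
  induction k with
  | zero => exact fun h => h [] rfl
  | succ k ih =>
    intro η h
    rw [mem_genFix_succ]
    refine fun g => ih fun l hl => ?_
    have := h (l ++ [g]) (by simp [hl])
    rwa [List.foldr_append] at this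

theorem pow_apply_eq_zero_of_mem_genFix {G V : Type*} [Group G] [AddCommGroup V] [Module ℂ V]
    {ρ : G →* Module.End ℂ V} (g : G) {k : ℕ} :
    ∀ {v : V}, v ∈ genFix ρ k → ((ρ g - 1) ^ k) v = 0 := by
  induction k with
  | zero => exact fun h => h
  | succ k ih =>
    intro v h
    rw [pow_succ, Module.End.mul_apply]
    exact ih ((mem_genFix_succ ρ).1 h g)

theorem pow_sub_one_apply {V : Type*} [AddCommGroup V] [Module ℂ V] {T : Module.End ℂ V} {v : V}
    {a : ℂ} (h : T v = a • v) (k : ℕ) : ((T - 1) ^ k) v = (a - 1) ^ k • v := by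
  induction k with
  | zero => simp
  | succ k ih =>
    rw [pow_succ', Module.End.mul_apply, ih, map_smul, LinearMap.sub_apply, h,
      Module.End.one_apply, pow_succ, mul_smul, sub_smul, one_smul]

theorem IsSemiInvDistrib.isGenSemiInvDistrib {χ₁ χ₂ : Kˣ →* ℂˣ}
    {η : SchwartzBZ (Matrix (Fin m) (Fin n) K) →ₗ[ℂ] ℂ} (h : IsSemiInvDistrib χ₁ χ₂ η) :
    IsGenSemiInvDistrib χ₁ χ₂ η := by
  refine ⟨0, fun l hl => ?_⟩
  obtain ⟨g, rfl⟩ := List.length_eq_one_iff.1 hl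
  exact sub_eq_zero.2 (h g)

theorem IsSemiInvDistrib.smul {χ₁ χ₂ : Kˣ →* ℂˣ}
    {η : SchwartzBZ (Matrix (Fin m) (Fin n) K) →ₗ[ℂ] ℂ} (h : IsSemiInvDistrib χ₁ χ₂ η) (c : ℂ) :
    IsSemiInvDistrib χ₁ χ₂ (c • η) := fun g => by
  rw [← distRep_apply, map_smul, distRep_apply, h g]

theorem IsGenSemiInvDistrib.slInv [CharZero K] (hm : 0 < m) (hn : 0 < n) {χ₁ χ₂ : Kˣ →* ℂˣ}
    {η : SchwartzBZ (Matrix (Fin m) (Fin n) K) →ₗ[ℂ] ℂ} (h : IsGenSemiInvDistrib χ₁ χ₂ η) :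
    SLInv η := by
  obtain ⟨k, h⟩ := h
  have hη := mem_genFix_distRep h
  have : NeZero m := ⟨hm.ne'⟩
  have : NeZero n := ⟨hn.ne'⟩
  intro g₁ g₂ hg₁ hg₂ φ
  have h1 := genFix_apply_eq_of_det _ (MonoidHom.inl _ _) hη hg₁
  have h2 := genFix_apply_eq_of_det _ (MonoidHom.inr (GL (Fin m) K) _) hη
    (g := g₂⁻¹) (by rw [map_inv, hg₂, inv_one])
  have h3 : distRep χ₁ χ₂ (g₁, g₂⁻¹) η = η := by
    have e : ((g₁, g₂⁻¹) : GL (Fin m) K × GL (Fin n) K)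
      = MonoidHom.inl _ _ g₁ * MonoidHom.inr _ _ g₂⁻¹ := by simp
    rw [e, map_mul, Module.End.mul_apply, h2, h1]
  have h4 := LinearMap.congr_fun h3 φ
  have e : pullbackS (matActHomeo g₁ g₂⁻¹) φ = pullH (actH g₁ g₂) φ := by
    ext x
    simp [matActHomeo]
  simpa [actDist, hg₁, hg₂, e] using h4

theorem actDist_deltaZero (χ₁ χ₂ : Kˣ →* ℂˣ) (g : GL (Fin m) K × GL (Fin n) K) :
    actDist χ₁ χ₂ g (deltaZero K m n)
      = ((χ₁ (Matrix.GeneralLinearGroup.det g.1) * χ₂ (Matrix.GeneralLinearGroup.det g.2) : ℂˣ) : ℂ)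
        • deltaZero K m n := by
  ext φ
  have : (pullbackS (matActHomeo g.1 g.2) φ : Matrix (Fin m) (Fin n) K → ℂ) 0
      = (φ : Matrix (Fin m) (Fin n) K → ℂ) 0 := by
    rw [pullbackS_apply]
    simp [matActHomeo]
  exact congrArg (_ * ·) this

theorem actDist_transInv [IsUltrametricDist K] [LocallyCompactSpace K] [CharZero K]
    [MeasurableSpace K] [BorelSpace K] (μK : Measure K) [μK.IsAddHaarMeasure]
    (hnormed : ∀ a : K, a ≠ 0 → ∀ s : Set K, MeasurableSet s →
      μK ((a * ·) '' s) = ENNReal.ofReal ‖a‖ * μK s) (hm : 0 < m) (hn : 0 < n)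
    {Λ : SchwartzBZ (Matrix (Fin m) (Fin n) K) →ₗ[ℂ] ℂ} (hΛ : TransInv Λ) (χ₁ χ₂ : Kˣ →* ℂˣ)
    (g : GL (Fin m) K × GL (Fin n) K) :
    actDist χ₁ χ₂ g Λ
      = (((χ₁ * (normChar K ^ (n : ℤ))⁻¹) (Matrix.GeneralLinearGroup.det g.1)
        * (χ₂ * (normChar K ^ (-(m : ℤ)))⁻¹) (Matrix.GeneralLinearGroup.det g.2) : ℂˣ) : ℂ)
        • Λ := by
  have : NeZero m := ⟨hm.ne'⟩
  have : NeZero n := ⟨hn.ne'⟩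
  ext φ
  have h := hΛ.apply_actH μK hnormed g.1 g.2⁻¹ φ
  have e : pullbackS (matActHomeo g.1 g.2) φ = pullH (actH g.1 g.2⁻¹) φ := rfl
  change _ * Λ _ = _ * Λ φ
  rw [e, h, ← GeneralLinearGroup.val_det_apply, ← GeneralLinearGroup.val_det_apply, map_inv]
  simp [normChar]
  ring

theorem eq_one_of_det_mul_det_eq_one (hm : 0 < m) (hn : 0 < n) {ψ₁ ψ₂ : Kˣ →* ℂˣ}
    (h : ∀ g : GL (Fin m) K × GL (Fin n) K, ψ₁ (Matrix.GeneralLinearGroup.det g.1)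
      * ψ₂ (Matrix.GeneralLinearGroup.det g.2) = 1) : ψ₁ = 1 ∧ ψ₂ = 1 := by
  constructor
  · ext a
    have := h (diagU (Pi.mulSingle ⟨0, hm⟩ a), 1)
    rw [det_diagU, Finset.prod_pi_mulSingle', map_one, map_one, mul_one] at this
    simpa using congrArg Units.val this
  · ext a
    have := h (1, diagU (Pi.mulSingle ⟨0, hn⟩ a))
    rw [det_diagU, Finset.prod_pi_mulSingle', map_one, map_one, one_mul] at this
    simpa using congrArg Units.val this

theorem normChar_zpow_ne_one {n : ℕ} (hn : 0 < n) : normChar K ^ (n : ℤ) ≠ 1 := by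
  intro h
  obtain ⟨t, ht⟩ := NormedField.exists_one_lt_norm K
  have h1 := congrArg Units.val
    (DFunLike.congr_fun h (Units.mk0 t (norm_pos_iff.1 (one_pos.trans ht))))
  have h2 : ‖t‖ ^ n = 1 := by
    simp [normChar] at h1
    exact_mod_cast h1
  exact (one_lt_pow₀ ht hn.ne').ne' h2

theorem eq_zero_of_smul_add_smul_deltaZero [IsUltrametricDist K] [LocallyCompactSpace K]
    (hm : 0 < m) (hn : 0 < n) {Λ : SchwartzBZ (Matrix (Fin m) (Fin n) K) →ₗ[ℂ] ℂ}
    (hΛ0 : ∀ L hL y, Λ (indC L hL y) ≠ 0) {a b : ℂ} (h : a • Λ + b • deltaZero K m n = 0) :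
    a = 0 ∧ b = 0 := by
  obtain ⟨t, ht⟩ := NormedField.exists_one_lt_norm K
  set L := matLat K (Fin m) (Fin n) 1 one_pos
  have hL : IsCompact (L : Set (Matrix (Fin m) (Fin n) K)) := isCompact_matLat 1 one_pos
  have hd : deltaZero K m n (indC L hL (Matrix.of fun _ _ => t)) = 0 := by
    refine indC_apply_of_notMem hL fun h0 => ?_
    have := mem_matLat.1 h0 ⟨0, hm⟩ ⟨0, hn⟩
    simp at this
    exact this.not_gt ht
  have ha : a = 0 := by
    have h1 := LinearMap.congr_fun h (indC L hL (Matrix.of fun _ _ => t))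
    simp only [LinearMap.add_apply, LinearMap.smul_apply, hd, smul_zero, add_zero] at h1
    exact (mul_eq_zero.1 h1).resolve_right (hΛ0 _ _ _)
  refine ⟨ha, ?_⟩
  have hd' : deltaZero K m n (indC L hL 0) = 1 :=
    indC_apply_of_mem hL (by rw [sub_zero]; exact zero_mem _)
  have h1 := LinearMap.congr_fun h (indC L hL 0)
  simpa [ha, hd'] using h1

theorem IsGenSemiInvDistrib.exists_eq [IsUltrametricDist K] [LocallyCompactSpace K]
    [TotallyDisconnectedSpace K] [CharZero K]
    [MeasurableSpace K] [BorelSpace K] (μK : Measure K) [μK.IsAddHaarMeasure]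
    (hnormed : ∀ a : K, a ≠ 0 → ∀ s : Set K, MeasurableSet s →
      μK ((a * ·) '' s) = ENNReal.ofReal ‖a‖ * μK s) (hm : 0 < m) (hn : 0 < n) (hmn : m ≠ n)
    {η Λ : SchwartzBZ (Matrix (Fin m) (Fin n) K) →ₗ[ℂ] ℂ} (hΛ : TransInv Λ)
    (hΛ0 : ∀ L hL y, Λ (indC L hL y) ≠ 0) {χ₁ χ₂ : Kˣ →* ℂˣ} (h : IsGenSemiInvDistrib χ₁ χ₂ η) :
    ∃ c c' : ℂ, η = c • Λ + c' • deltaZero K m n ∧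
      (c ≠ 0 → χ₁ = normChar K ^ (n : ℤ) ∧ χ₂ = normChar K ^ (-(m : ℤ))) ∧
      (c' ≠ 0 → χ₁ = 1 ∧ χ₂ = 1) := by
  obtain ⟨c, c', rfl⟩ := (h.slInv hm hn).exists_eq μK hnormed hm hn hmn hΛ hΛ0
  obtain ⟨k, h⟩ := h
  have key := fun g => by
    have := pow_apply_eq_zero_of_mem_genFix g (mem_genFix_distRep h)
    rw [map_add, map_smul, map_smul,
      pow_sub_one_apply (actDist_transInv μK hnormed hm hn hΛ χ₁ χ₂ g :
        distRep χ₁ χ₂ g _ = _),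
      pow_sub_one_apply (actDist_deltaZero χ₁ χ₂ g : distRep χ₁ χ₂ g _ = _), smul_smul,
      smul_smul] at this
    exact eq_zero_of_smul_add_smul_deltaZero hm hn hΛ0 this
  refine ⟨c, c', rfl, fun hc => ?_, fun hc => ?_⟩
  · have := eq_one_of_det_mul_det_eq_one hm hn fun g => Units.ext (sub_eq_zero.1
      ((pow_eq_zero_iff k.succ_ne_zero).1 ((mul_eq_zero.1 (key g).1).resolve_left hc)))
    exact ⟨mul_inv_eq_one.1 this.1, mul_inv_eq_one.1 this.2⟩
  · exact eq_one_of_det_mul_det_eq_one hm hn fun g => Units.ext (sub_eq_zero.1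
      ((pow_eq_zero_iff k.succ_ne_zero).1 ((mul_eq_zero.1 (key g).2).resolve_left hc)))

end Characters

/-- Let `k` be a non-archimedean local field of characteristic zero (with
its normalized absolute value, characterized by the scaling of an additive Haar measure),
let `m ≠ n` be positive integers and `G = GL_m(k) × GL_n(k)` act on `M_{m,n}(k)` by
`(g₁,g₂)·x = g₁ x g₂⁻¹`.  Then for characters `(χ₁,χ₂)` of `G`:
(a) if `(χ₁,χ₂) = (1,1)`, the generalized `(χ₁,χ₂)`-invariant distributions and the
`(χ₁,χ₂)`-invariant distributions both form the line `ℂ·δ₀`;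
(b) if `(χ₁,χ₂) = (|·|^n, |·|^{−m})`, both spaces are the line `ℂ·μ` spanned by a Haar
measure `μ` of `M_{m,n}(k)`;
(c) for all other `(χ₁,χ₂)`, there is no nonzero generalized `(χ₁,χ₂)`-invariant
distribution. -/
theorem gen_semiInvariant_distributions_on_matrix_space
    (K : Type*) [NontriviallyNormedField K] [LocallyCompactSpace K]
    [TotallyDisconnectedSpace K] [CharZero K]
    [MeasurableSpace K] [BorelSpace K] (μK : Measure K) [μK.IsAddHaarMeasure]
    (hnormed : ∀ a : K, a ≠ 0 → ∀ s : Set K, MeasurableSet s →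
      μK ((a * ·) '' s) = ENNReal.ofReal ‖a‖ * μK s)
    (m n : ℕ) (hm : 0 < m) (hn : 0 < n) (hmn : m ≠ n)
    [MeasurableSpace (Matrix (Fin m) (Fin n) K)]
    [BorelSpace (Matrix (Fin m) (Fin n) K)]
    (μ : Measure (Matrix (Fin m) (Fin n) K)) [μ.IsAddHaarMeasure]
    (χ₁ χ₂ : Kˣ →* ℂˣ)
    (hχ₁ : IsLocallyConstant fun a : Kˣ => (χ₁ a : ℂ))
    (hχ₂ : IsLocallyConstant fun a : Kˣ => (χ₂ a : ℂ)) :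
    ((χ₁ = 1 ∧ χ₂ = 1) →
      (∀ η : SchwartzBZ (Matrix (Fin m) (Fin n) K) →ₗ[ℂ] ℂ, IsGenSemiInvDistrib χ₁ χ₂ η ↔ ∃ c : ℂ, η = c • deltaZero K m n) ∧
      (∀ η : SchwartzBZ (Matrix (Fin m) (Fin n) K) →ₗ[ℂ] ℂ, IsSemiInvDistrib χ₁ χ₂ η ↔ ∃ c : ℂ, η = c • deltaZero K m n)) ∧
    ((χ₁ = normChar K ^ (n : ℤ) ∧ χ₂ = normChar K ^ (-(m : ℤ))) →
      (∀ η : SchwartzBZ (Matrix (Fin m) (Fin n) K) →ₗ[ℂ] ℂ, IsGenSemiInvDistrib χ₁ χ₂ η ↔ ∃ c : ℂ, η = c • measDist K m n μ) ∧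
      (∀ η : SchwartzBZ (Matrix (Fin m) (Fin n) K) →ₗ[ℂ] ℂ, IsSemiInvDistrib χ₁ χ₂ η ↔ ∃ c : ℂ, η = c • measDist K m n μ)) ∧
    ((¬(χ₁ = 1 ∧ χ₂ = 1) ∧
        ¬(χ₁ = normChar K ^ (n : ℤ) ∧ χ₂ = normChar K ^ (-(m : ℤ)))) →
      ∀ η : SchwartzBZ (Matrix (Fin m) (Fin n) K) →ₗ[ℂ] ℂ, IsGenSemiInvDistrib χ₁ χ₂ η → η = 0) := by
  have := isUltrametricDist_of_totallyDisconnected K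
  have hΛ : TransInv (measDist K m n μ) := transInv_intS μ
  have hΛ0 : ∀ L hL y, measDist K m n μ (indC L hL y) ≠ 0 := intS_indC_ne_zero μ
  refine ⟨?_, ?_, ?_⟩
  · rintro ⟨rfl, rfl⟩
    have h1 : IsSemiInvDistrib 1 1 (deltaZero K m n) := fun g => by
      rw [actDist_deltaZero]
      simp
    have h2 : ∀ η : SchwartzBZ (Matrix (Fin m) (Fin n) K) →ₗ[ℂ] ℂ,
        IsGenSemiInvDistrib 1 1 η → ∃ c : ℂ, η = c • deltaZero K m n := fun η h => by
      obtain ⟨c, c', rfl, hc, -⟩ := h.exists_eq μK hnormed hm hn hmn hΛ hΛ0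
      obtain rfl : c = 0 := by_contra fun h0 => normChar_zpow_ne_one hn (hc h0).1.symm
      exact ⟨c', by rw [zero_smul, zero_add]⟩
    refine ⟨fun η => ⟨h2 η, ?_⟩, fun η => ⟨fun h => h2 η h.isGenSemiInvDistrib, ?_⟩⟩ <;>
      rintro ⟨c, rfl⟩
    exacts [(h1.smul c).isGenSemiInvDistrib, h1.smul c]
  · rintro ⟨rfl, rfl⟩
    have h1 : IsSemiInvDistrib (normChar K ^ (n : ℤ)) (normChar K ^ (-(m : ℤ)))
        (measDist K m n μ) := fun g => by
      rw [actDist_transInv μK hnormed hm hn hΛ]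
      simp only [MonoidHom.mul_apply, MonoidHom.inv_apply, _root_.mul_inv_cancel, mul_one,
        Units.val_one, one_smul]
    have h2 : ∀ η : SchwartzBZ (Matrix (Fin m) (Fin n) K) →ₗ[ℂ] ℂ,
        IsGenSemiInvDistrib (normChar K ^ (n : ℤ)) (normChar K ^ (-(m : ℤ))) η →
          ∃ c : ℂ, η = c • measDist K m n μ := fun η h => by
      obtain ⟨c, c', rfl, -, hc⟩ := h.exists_eq μK hnormed hm hn hmn hΛ hΛ0
      obtain rfl : c' = 0 := by_contra fun h0 => normChar_zpow_ne_one hn (hc h0).1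
      exact ⟨c, by rw [zero_smul, add_zero]⟩
    refine ⟨fun η => ⟨h2 η, ?_⟩, fun η => ⟨fun h => h2 η h.isGenSemiInvDistrib, ?_⟩⟩ <;>
      rintro ⟨c, rfl⟩
    exacts [(h1.smul c).isGenSemiInvDistrib, h1.smul c]
  · rintro ⟨hne, hne'⟩ η h
    obtain ⟨c, c', rfl, hc, hc'⟩ := h.exists_eq μK hnormed hm hn hmn hΛ hΛ0
    rw [by_contra fun h0 : c ≠ 0 => hne' (hc h0), by_contra fun h0 : c' ≠ 0 => hne (hc' h0),
      zero_smul, zero_smul, add_zero]
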